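/- arXiv:2311.12545 — 2 statements merged into one kernel-verified Lean document; each statement's English description precedes it below -/
import Mathlib

section
/- Let f(𝐱) = F₁(𝐱') + ωF₂(𝐱') ∈ 𝒢𝒮ℛ(Ω_D). Then F₁ and F₂ are real analytic on D, and f is real analytic on Ω_D; moreover there exist real analytic functions G₁, G₂ such that F₁(𝐱_p, r) = G₁(𝐱_p, r²) and F₂(𝐱_p, r) = r G₂(𝐱_p, r²) for all (𝐱_p, r) ∈ D, so that f(𝐱_p + 𝐱_q) = G₁(𝐱_p, r²) + 𝐱_q G₂(𝐱_p, r²) with r = |𝐱_q|. -/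
/-!
Common framework for generalized partial-slice monogenic functions
(Xu–Sabadini, "On the Fueter-Sce theorem for generalized partial-slice
monogenic functions").

The real Clifford algebra `ℝ_{p+q}` is formalized as the Mathlib Clifford
algebra of the negative-definite quadratic form on `ℝ^{p+q}`; since Mathlib
provides no canonical norm on it, all analytic statements are phrased for an
arbitrary normed real algebra `A` together with an `ℝ`-algebra isomorphism
`ξ : A ≃ₐ[ℝ] Cl (p+q)`.  A point of `ℝ^{p+q+1}` is a pair
`(𝐱_p, 𝐱_q) : (Fin (p+1) → ℝ) × EuclideanSpace ℝ (Fin q)`, and a point of a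
slice `ℝ^{p+2}` is a pair `(𝐱_p, r)`.
-/

noncomputable section

open Filter Topology MeasureTheory Metric
open scoped Nat RealInnerProductSpace

namespace GPS

/-- The negative definite quadratic form `-(x₁² + ⋯ + xₙ²)` on `ℝⁿ`. -/
def Qe (n : ℕ) : QuadraticForm ℝ (Fin n → ℝ) :=
  QuadraticMap.weightedSumSquares ℝ (fun _ : Fin n => (-1 : ℝ))

/-- The real Clifford algebra `ℝ_n`. -/
abbrev Cl (n : ℕ) : Type := CliffordAlgebra (Qe n)

/-- The generators `e_1, …, e_n` of `ℝ_n` (indexed by `Fin n`). -/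
def e (n : ℕ) (i : Fin n) : Cl n := CliffordAlgebra.ι (Qe n) (Pi.single i 1)

variable (p q : ℕ)

/-- `ℝ^{p+1}`, the "slice-axis" space. -/
abbrev Vp : Type := Fin (p + 1) → ℝ

/-- `ℝ^q`. -/
abbrev Vq : Type := EuclideanSpace ℝ (Fin q)

/-- `ℝ^{p+q+1} = ℝ^{p+1} ⊕ ℝ^q`. -/
abbrev V : Type := Vp p × Vq q

/-- `ℝ^{p+2}`, the parameter space `(𝐱_p, r)` of a slice. -/
abbrev Sl : Type := Vp p × ℝ

/-- The sphere `𝕊` of unit 1-vectors, described by their coordinate vectors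
`(x_{p+1}, …, x_{p+q}) ∈ ℝ^q` with `∑ x_i² = 1`. -/
def S : Set (Vq q) := {v | ∑ j, v j ^ 2 = 1}

/-- The point `𝐱_p + r ω` of `ℝ^{p+q+1}`. -/
def spt (v : Vq q) (z : Sl p) : V p q := (z.1, z.2 • v)

/-- The (parameterized) slice `Ω_ω` of a set `Ω ⊆ ℝ^{p+q+1}`. -/
def sliceSet (Ω : Set (V p q)) (v : Vq q) : Set (Sl p) := {z | spt p q v z ∈ Ω}

/-- `Ω₀* = {𝐱_p + 𝐱_q : 𝐱_p ∈ Ω₀, 𝐱_q ∈ ℝ^q}`. -/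
def star0 (Ω₀ : Set (Vp p)) : Set (V p q) := {z | z.1 ∈ Ω₀}

/-- The p-symmetric completion `Ω_D` of a set `D ⊆ ℝ^{p+2}`. -/
def completion (D : Set (Sl p)) : Set (V p q) :=
  {x | ∃ z ∈ D, ∃ v ∈ S q, x = spt p q v z}

/-- `D` is invariant under the reflection of the `(p+2)`-th variable. -/
def ReflInv (D : Set (Sl p)) : Prop := ∀ z ∈ D, ((z.1, -z.2) : Sl p) ∈ D

/-- A domain: a nonempty open connected set. -/
def IsDomain {E : Type*} [TopologicalSpace E] (s : Set E) : Prop :=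
  IsOpen s ∧ IsConnected s

/-- A slice domain. -/
def IsSliceDomain (Ω : Set (V p q)) : Prop :=
  IsDomain Ω ∧ (∃ x : Vp p, ((x, 0) : V p q) ∈ Ω) ∧
    ∀ v ∈ S q, IsDomain (sliceSet p q Ω v)

/-- Partial symmetry with respect to `ℝ^{p+1}`. -/
def IsPSymmetric (Ω : Set (V p q)) : Prop :=
  ∀ (x : Vp p) (r : ℝ), ∀ v ∈ S q, ∀ w ∈ S q,
    ((x, r • v) : V p q) ∈ Ω → ((x, r • w) : V p q) ∈ Ω

/-- A `d`-dimensional smooth submanifold of a real normed space. -/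
def IsSmoothSubmanifoldDim {E : Type*} [NormedAddCommGroup E] [NormedSpace ℝ E]
    (d : ℕ) (M : Set E) : Prop :=
  ∀ x ∈ M, ∃ U : Set E, IsOpen U ∧ x ∈ U ∧
    ∃ (ψ : (Fin d → ℝ) → E) (W : Set (Fin d → ℝ)), IsOpen W ∧
      ContDiffOn ℝ (⊤ : ℕ∞) ψ W ∧ Set.InjOn ψ W ∧
      (∀ y ∈ W, Function.Injective (fderivWithin ℝ ψ W y)) ∧
      M ∩ U = ψ '' W

variable {A : Type*} [NormedRing A] [NormedAlgebra ℝ A] (ξ : A ≃ₐ[ℝ] Cl (p + q))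

/-- The generators `e_1, …, e_{p+q}` inside `A`. -/
def gen (i : Fin (p + q)) : A := ξ.symm (e (p + q) i)

/-- The generators `e_{p+1}, …, e_{p+q}` (the "q-part"). -/
def eQ (j : Fin q) : A := gen p q ξ ⟨p + (j : ℕ), by have := j.isLt; omega⟩

/-- The generators `e_1, …, e_p` (the "p-part", without `e_0 = 1`). -/
def eP (i : Fin p) : A := gen p q ξ ⟨(i : ℕ), by have := i.isLt; omega⟩

/-- `e_0 = 1, e_1, …, e_p`: the paravector basis of `ℝ^{p+1}` inside `A`. -/
def εp (i : Fin (p + 1)) : A :=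
  if h : (i : ℕ) = 0 then 1 else gen p q ξ ⟨(i : ℕ) - 1, by have := i.isLt; omega⟩

/-- The 1-vector `∑ x_i e_{p+i} ∈ A` corresponding to `𝐱_q ∈ ℝ^q`;
for a unit `v` this is the imaginary unit `ω ∈ 𝕊`. -/
def ωCl (v : Vq q) : A := ∑ j, v j • eQ p q ξ j

/-- The paravector `x_0 + x_1 e_1 + ⋯ + x_p e_p ∈ A` of `𝐱_p ∈ ℝ^{p+1}`. -/
def clP (x : Vp p) : A := ∑ i, x i • εp p q ξ i

/-- The paravector of `𝐱 ∈ ℝ^{p+q+1}` in `A`. -/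
def toCl (z : V p q) : A := clP p q ξ z.1 + ωCl p q ξ z.2

section SliceOperators

variable {F' : Type*} [NormedAddCommGroup F'] [NormedSpace ℝ F']

/-- `∂_{x_i}` on functions on `ℝ^{p+2}`. -/
def pdSl (i : Fin (p + 1)) (F : Sl p → F') : Sl p → F' :=
  fun z => fderiv ℝ F z (Pi.single i 1, 0)

/-- `∂_r` on functions on `ℝ^{p+2}`. -/
def pdr (F : Sl p → F') : Sl p → F' := fun z => fderiv ℝ F z (0, 1)

/-- `∂_{x_i}` (first factor) on functions on `ℝ^{p+q+1}`. -/
def pdV1 (i : Fin (p + 1)) (f : V p q → F') : V p q → F' :=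
  fun z => fderiv ℝ f z ((Pi.single i 1 : Vp p), 0)

/-- `∂_{x_{p+j}}` (second factor) on functions on `ℝ^{p+q+1}`. -/
def pdV2 (j : Fin q) (f : V p q → F') : V p q → F' :=
  fun z => fderiv ℝ f z (0, EuclideanSpace.single j 1)

/-- `∂_{x_i}` on functions on `ℝ^{p+1}`. -/
def pdP (i : Fin (p + 1)) (g : Vp p → F') : Vp p → F' :=
  fun x => fderiv ℝ g x (Pi.single i 1)

/-- The Laplacian `Δ_{𝐱'} = Δ_{𝐱_p} + ∂_r²` on `ℝ^{p+2}`. -/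
def LapSl (F : Sl p → F') : Sl p → F' :=
  fun z => ∑ i, pdSl p (i := i) (pdSl p i F) z + pdr p (pdr p F) z

/-- The Laplacian `Δ_𝐱` on `ℝ^{p+q+1}`. -/
def LapV (f : V p q → F') : V p q → F' :=
  fun z => ∑ i, pdV1 p q i (pdV1 p q i f) z + ∑ j, pdV2 p q j (pdV2 p q j f) z

/-- The Laplacian `Δ_{𝐱_p}` on `ℝ^{p+1}`. -/
def LapP (g : Vp p → F') : Vp p → F' :=
  fun x => ∑ i, pdP p i (pdP p i g) x

end SliceOperators

/-- The generalized Cauchy–Riemann operator `D_{𝐱_p} = ∑_{i=0}^p e_i ∂_{x_i}`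
on slice functions. -/
def DP (F : Sl p → A) : Sl p → A :=
  fun z => ∑ i, εp p q ξ i * pdSl p i F z

/-- The conjugated operator `D̄_{𝐱_p} = ∂_{x_0} - ∑_{i=1}^p e_i ∂_{x_i}`. -/
def DPbar (F : Sl p → A) : Sl p → A :=
  fun z => pdSl p 0 F z - ∑ i : Fin p, eP p q ξ i * pdSl p i.succ F z

/-- The generalized Cauchy–Riemann (Dirac) operator `D_𝐱` on `ℝ^{p+q+1}`. -/
def DV (f : V p q → A) : V p q → A :=
  fun z => ∑ i, εp p q ξ i * pdV1 p q i f z + ∑ j, eQ p q ξ j * pdV2 p q j f z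

/-- `D_{𝐱_p} = ∑_{i=0}^p e_i ∂_{x_i}` on functions on `ℝ^{p+1}`. -/
def DPfun (g : Vp p → A) : Vp p → A :=
  fun x => ∑ i, εp p q ξ i * pdP p i g x

/-- The slice operator `D_ω = D_{𝐱_p} + ω ∂_r`, expressed on `ℝ^{p+q+1} ∖ ℝ^{p+1}`
(at `𝐱_q = 0` the radial part is junk `0`). -/
def Dslice (f : V p q → A) : V p q → A :=
  fun z => ∑ i, εp p q ξ i * pdV1 p q i f z
    + ωCl p q ξ (‖z.2‖⁻¹ • z.2) * fderiv ℝ f z (0, ‖z.2‖⁻¹ • z.2)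

/-- The spherical Dirac operator `Γ = -∑_{i<j} e_i e_j L_{ij}` on the `ℝ^q` variables. -/
def sphericalDirac (f : V p q → A) : V p q → A :=
  fun z => - ∑ i : Fin q, ∑ j : Fin q,
    if (i : ℕ) < (j : ℕ) then
      eQ p q ξ i * eQ p q ξ j *
        (z.2 i • pdV2 p q j f z - z.2 j • pdV2 p q i f z)
    else 0

/-- `f` is left generalized partial-slice monogenic of type `(p,q)` on `Ω`. -/
def GSMOn (Ω : Set (V p q)) (f : V p q → A) : Prop :=
  ∀ v ∈ S q,
    ContDiffOn ℝ 1 (fun z => f (spt p q v z)) (sliceSet p q Ω v) ∧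
    ∀ z ∈ sliceSet p q Ω v,
      DP p q ξ (fun w => f (spt p q v w)) z
        + ωCl p q ξ v * pdr p (fun w => f (spt p q v w)) z = 0

/-- `f` is (left) monogenic on `Ω`. -/
def MonogenicOn (Ω : Set (V p q)) (f : V p q → A) : Prop :=
  ContDiffOn ℝ 1 f Ω ∧ ∀ z ∈ Ω, DV p q ξ f z = 0

/-- `f` is the generalized partial-slice function on `Ω_D` with components `F1, F2`
(an even–odd pair in the last variable). -/
def IsGPSlice (D : Set (Sl p)) (f : V p q → A) (F1 F2 : Sl p → A) : Prop :=
  (∀ z ∈ D, F1 (z.1, -z.2) = F1 z ∧ F2 (z.1, -z.2) = -F2 z) ∧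
  ∀ z ∈ D, ∀ v ∈ S q, f (spt p q v z) = F1 z + ωCl p q ξ v * F2 z

/-- The generalized Cauchy–Riemann system (2.6) for the pair `(F1, F2)`. -/
def CRSystem (D : Set (Sl p)) (F1 F2 : Sl p → A) : Prop :=
  ∀ z ∈ D, DP p q ξ F1 z - pdr p F2 z = 0 ∧ DPbar p q ξ F2 z + pdr p F1 z = 0

/-- `f ∈ 𝒢𝒮ℛ(Ω_D)` with the given components. -/
def GSROnWith (D : Set (Sl p)) (f : V p q → A) (F1 F2 : Sl p → A) : Prop :=
  IsGPSlice p q ξ D f F1 F2 ∧ ContDiffOn ℝ 1 F1 D ∧ ContDiffOn ℝ 1 F2 D ∧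
    CRSystem p q ξ D F1 F2

/-- `f ∈ 𝒢𝒮ℛ(Ω_D)`. -/
def GSROn (D : Set (Sl p)) (f : V p q → A) : Prop :=
  ∃ F1 F2, GSROnWith p q ξ D f F1 F2

/-- Iterates `((1/r) ∂_r)^k F`. -/
def AIter (F : Sl p → A) : ℕ → Sl p → A
  | 0 => F
  | k + 1 => fun z => z.2⁻¹ • pdr p (AIter F k) z

/-- Iterates `(∂_r (1/r))^k F`. -/
def BIter (F : Sl p → A) : ℕ → Sl p → A
  | 0 => F
  | k + 1 => fun z => fderiv ℝ (fun w : Sl p => w.2⁻¹ • BIter F k w) z (0, 1)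

/-- `C_q(k) = (q-1)(q-3)⋯(q-2k+1)`. -/
def Cq (k : ℕ) : ℝ := ∏ j ∈ Finset.range k, ((q : ℝ) - (2 * (j : ℝ) + 1))

/-- The Fueter–Sce map `τ_q = (1/(q-1)!!) Δ^{(q-1)/2}` (for odd `q`). -/
def tauq (f : V p q → A) : V p q → A :=
  fun z => (((q - 1)‼ : ℝ))⁻¹ • (LapV p q)^[(q - 1) / 2] f z

/-- `(𝐱_q D_{𝐱_p})^k`, for a fixed Clifford element `u` in place of `𝐱_q`. -/
def uDpow (u : A) : ℕ → (Vp p → A) → Vp p → A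
  | 0 => fun g => g
  | k + 1 => fun g x => u * DPfun p q ξ (uDpow u k g) x

/-- The `k`-th term of the slice Cauchy–Kovalevskaya extension series. -/
def ckTerm (f₀ : Vp p → A) (k : ℕ) (z : V p q) : A :=
  ((k ! : ℝ))⁻¹ • uDpow p q ξ (ωCl p q ξ z.2) k f₀ z.1

/-- The slice Cauchy–Kovalevskaya extension `CK[f₀]`. -/
def CKext (f₀ : Vp p → A) (z : V p q) : A := ∑' k, ckTerm p q ξ f₀ k z

/-- The `k`-th term of the CK-extension for a fixed direction `w`. -/
def ckDirTerm (w : Vq q) (f₀ : Vp p → A) (k : ℕ) (z : V p q) : A :=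
  ((⟪w, z.2⟫) ^ k / (k ! : ℝ)) • uDpow p q ξ (ωCl p q ξ w) k f₀ z.1

/-- The CK-extension for a fixed direction `w ∈ 𝕊`. -/
def CKdir (w : Vq q) (f₀ : Vp p → A) (z : V p q) : A :=
  ∑' k, ckDirTerm p q ξ w f₀ k z

/-- The coefficients of the generalized CK-extension:
`f_{2k} = (Γ(q/2) / (2^{2k} k! Γ(k+q/2))) Δ^k f₀` and
`f_{2k+1} = (Γ(q/2) / (2^{2k+1} k! Γ(k+q/2+1))) D Δ^k f₀`. -/
def gckCoeff (f₀ : Vp p → A) (k : ℕ) : Vp p → A :=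
  if k % 2 = 0 then
    fun x => (Real.Gamma ((q : ℝ) / 2) /
        (2 ^ k * ((k / 2)! : ℝ) * Real.Gamma (((k / 2 : ℕ) : ℝ) + (q : ℝ) / 2))) •
      (LapP p)^[k / 2] f₀ x
  else
    fun x => (Real.Gamma ((q : ℝ) / 2) /
        (2 ^ k * ((k / 2)! : ℝ) * Real.Gamma (((k / 2 : ℕ) : ℝ) + (q : ℝ) / 2 + 1))) •
      DPfun p q ξ ((LapP p)^[k / 2] f₀) x

/-- The `k`-th term `𝐱_q^k f_k(𝐱_p)` of the generalized CK-extension series. -/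
def gckTerm (f₀ : Vp p → A) (k : ℕ) (z : V p q) : A :=
  (ωCl p q ξ z.2) ^ k * gckCoeff p q ξ f₀ k z.1

/-- The generalized CK-extension `GCK[f₀]`. -/
def GCKext (f₀ : Vp p → A) (z : V p q) : A := ∑' k, gckTerm p q ξ f₀ k z

/-- The Radon transform `R[f](𝐱_p, r, ω) = ∫_{⟨𝐱_q,ω⟩=r} f(𝐱_p, 𝐱_q) dσ(𝐱_q)`. -/
def radon (f : V p q → A) (x : Vp p) (r : ℝ) (w : Vq q) : A :=
  ∫ u : ((Submodule.span ℝ {w})ᗮ : Submodule ℝ (Vq q)),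
    f (x, r • w + (u : Vq q))

/-- The (suitably normalized) surface measure on the unit sphere of `ℝ^q`. -/
def sphMeasure : Measure (sphere (0 : Vq q) 1) := volume.toSphere

/-- The dual Radon transform
`Ř[f](𝐱_p, 𝐱_q) = (1/A_q) ∫_𝕊 f(𝐱_p, ⟨𝐱_q, η⟩ η) dS(η)` (a spherical average). -/
def dualRadon (f : V p q → A) (z : V p q) : A :=
  ⨍ w : sphere (0 : Vq q) 1,
    f (z.1, (⟪((w : Vq q)), z.2⟫) • (w : Vq q)) ∂(sphMeasure q)

end GPS

open GPS

theorem finiteDimensional_exteriorAlgebra (n : ℕ) :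
    FiniteDimensional ℝ (ExteriorAlgebra ℝ (Fin n → ℝ)) := by
  have hbot : ∀ k, n < k → (⋀[ℝ]^k (Fin n → ℝ)) = ⊥ := by
    intro k hk
    have h := exteriorPower.finrank_eq (R := ℝ) (M := Fin n → ℝ) k
    rw [Module.finrank_fin_fun, Nat.choose_eq_zero_of_lt hk] at h
    exact Submodule.finrank_eq_zero.mp h
  have htop : (⨆ k, (⋀[ℝ]^k (Fin n → ℝ))) = ⊤ :=
    (DirectSum.Decomposition.isInternal
      (fun k : ℕ => (⋀[ℝ]^k (Fin n → ℝ)))).submodule_iSup_eq_top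
  have hfin : (⨆ k : Fin (n + 1), (⋀[ℝ]^(k : ℕ) (Fin n → ℝ))) = ⊤ := by
    rw [eq_top_iff, ← htop]
    refine iSup_le fun k => ?_
    by_cases hk : n < k
    · rw [hbot k hk]; exact bot_le
    · exact le_iSup (fun k : Fin (n + 1) => (⋀[ℝ]^(k : ℕ) (Fin n → ℝ))) ⟨k, by omega⟩
  refine Module.finite_def.mpr ?_
  rw [← hfin]
  exact Submodule.fg_iSup _ fun k => Module.Finite.iff_fg.mp inferInstance

theorem finiteDimensional_cl (n : ℕ) : FiniteDimensional ℝ (Cl n) := by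
  have := finiteDimensional_exteriorAlgebra n
  have : Invertible (2 : ℝ) := invertibleOfNonzero two_ne_zero
  exact Module.Finite.equiv (CliffordAlgebra.equivExterior (Qe n)).symm

/-- `F` splits near `(x₀, 0)` as `F (x, r) = G₁ (x, r²) + r G₂ (x, r²)` with `G₁, G₂` analytic
at `(x₀, 0)`. -/
def AnalyticSplitAt {E B : Type*} [NormedAddCommGroup E] [NormedSpace ℝ E]
    [NormedAddCommGroup B] [NormedSpace ℝ B] (F : E × ℝ → B) (x₀ : E) : Prop :=
  ∃ G₁ G₂ : E × ℝ → B, AnalyticAt ℝ G₁ (x₀, 0) ∧ AnalyticAt ℝ G₂ (x₀, 0) ∧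
    ∀ᶠ z in 𝓝 (x₀, (0 : ℝ)), F z = G₁ (z.1, z.2 ^ 2) + z.2 • G₂ (z.1, z.2 ^ 2)

namespace AnalyticSplitAt

section Module

variable {E B C : Type*} [NormedAddCommGroup E] [NormedSpace ℝ E]
  [NormedAddCommGroup B] [NormedSpace ℝ B] [NormedAddCommGroup C] [NormedSpace ℝ C] {x₀ : E}

theorem congr {F F' : E × ℝ → B} (h : AnalyticSplitAt F x₀)
    (h' : F' =ᶠ[𝓝 (x₀, (0 : ℝ))] F) : AnalyticSplitAt F' x₀ := by
  obtain ⟨G₁, G₂, h₁, h₂, h₃⟩ := h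
  refine ⟨G₁, G₂, h₁, h₂, ?_⟩
  filter_upwards [h₃, h'] with z hz hz'
  rw [hz', hz]

theorem of_fst {g : E → B} (hg : AnalyticAt ℝ g x₀) :
    AnalyticSplitAt (fun z : E × ℝ => g z.1) x₀ :=
  ⟨fun z => g z.1, fun _ => 0, AnalyticAt.fun_comp (g := g) hg analyticAt_fst, analyticAt_const,
    by simp⟩

theorem const (b : B) : AnalyticSplitAt (fun _ : E × ℝ => b) x₀ :=
  of_fst (g := fun _ => b) analyticAt_const

theorem snd_smul (b : B) : AnalyticSplitAt (fun z : E × ℝ => z.2 • b) x₀ :=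
  ⟨fun _ => 0, fun _ => b, analyticAt_const, analyticAt_const, by simp⟩

theorem add {F F' : E × ℝ → B} (h : AnalyticSplitAt F x₀) (h' : AnalyticSplitAt F' x₀) :
    AnalyticSplitAt (fun z => F z + F' z) x₀ := by
  obtain ⟨G₁, G₂, h₁, h₂, h₃⟩ := h
  obtain ⟨G₁', G₂', h₁', h₂', h₃'⟩ := h'
  refine ⟨fun z => G₁ z + G₁' z, fun z => G₂ z + G₂' z, h₁.add h₁', h₂.add h₂', ?_⟩
  filter_upwards [h₃, h₃'] with z hz hz'
  rw [hz, hz', smul_add]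
  abel

theorem sum {ι : Type*} (s : Finset ι) {F : ι → E × ℝ → B}
    (h : ∀ i ∈ s, AnalyticSplitAt (F i) x₀) :
    AnalyticSplitAt (fun z => ∑ i ∈ s, F i z) x₀ := by
  classical
  induction s using Finset.induction_on with
  | empty => simpa using const (E := E) (x₀ := x₀) (0 : B)
  | insert i s hi ih =>
    simp only [Finset.sum_insert hi]
    exact (h i (by simp)).add (ih fun j hj => h j (by simp [hj]))

theorem clm_apply {F : E × ℝ → B} (h : AnalyticSplitAt F x₀) (L : B →L[ℝ] C) :
    AnalyticSplitAt (fun z => L (F z)) x₀ := by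
  obtain ⟨G₁, G₂, h₁, h₂, h₃⟩ := h
  refine ⟨fun z => L (G₁ z), fun z => L (G₂ z), (L.analyticAt _).fun_comp h₁,
    (L.analyticAt _).fun_comp h₂, ?_⟩
  filter_upwards [h₃] with z hz
  rw [hz, map_add, map_smul]

theorem analyticAt {F : E × ℝ → B} (h : AnalyticSplitAt F x₀) : AnalyticAt ℝ F (x₀, 0) := by
  obtain ⟨G₁, G₂, h₁, h₂, h₃⟩ := h
  have hsq : AnalyticAt ℝ (fun z : E × ℝ => (z.1, z.2 ^ 2)) (x₀, (0 : ℝ)) :=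
    analyticAt_fst.prod (analyticAt_snd.pow 2)
  refine AnalyticAt.congr ?_ (h₃.mono fun z hz => hz.symm)
  exact (AnalyticAt.fun_comp_of_eq h₁ hsq (by simp)).add
    (analyticAt_snd.smul (AnalyticAt.fun_comp_of_eq h₂ hsq (by simp)))

theorem exists_of_even {F : E × ℝ → B} (h : AnalyticSplitAt F x₀)
    (heven : ∀ᶠ z in 𝓝 (x₀, (0 : ℝ)), F (z.1, -z.2) = F z) :
    ∃ G : E × ℝ → B, AnalyticAt ℝ G (x₀, 0) ∧
      ∀ᶠ z in 𝓝 (x₀, (0 : ℝ)), F z = G (z.1, z.2 ^ 2) := by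
  obtain ⟨G₁, G₂, h₁, h₂, h₃⟩ := h
  refine ⟨G₁, h₁, ?_⟩
  have hneg : Tendsto (fun z : E × ℝ => (z.1, -z.2)) (𝓝 (x₀, 0)) (𝓝 (x₀, 0)) := by
    have : Continuous (fun z : E × ℝ => (z.1, -z.2)) := by fun_prop
    simpa using this.tendsto (x₀, 0)
  filter_upwards [h₃, hneg.eventually h₃, heven] with z hz hz' he
  have h2 : (2 : ℝ) • F z = (2 : ℝ) • G₁ (z.1, z.2 ^ 2) := by
    rw [two_smul, two_smul]
    nth_rewrite 1 [← he]
    rw [hz', hz]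
    simp only [even_two, Even.neg_pow, neg_smul]
    abel
  exact smul_right_injective B (two_ne_zero : (2 : ℝ) ≠ 0) h2

theorem exists_of_odd {F : E × ℝ → B} (h : AnalyticSplitAt F x₀)
    (hodd : ∀ᶠ z in 𝓝 (x₀, (0 : ℝ)), F (z.1, -z.2) = -F z) :
    ∃ G : E × ℝ → B, AnalyticAt ℝ G (x₀, 0) ∧
      ∀ᶠ z in 𝓝 (x₀, (0 : ℝ)), F z = z.2 • G (z.1, z.2 ^ 2) := by
  obtain ⟨G₁, G₂, h₁, h₂, h₃⟩ := h
  refine ⟨G₂, h₂, ?_⟩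
  have hneg : Tendsto (fun z : E × ℝ => (z.1, -z.2)) (𝓝 (x₀, 0)) (𝓝 (x₀, 0)) := by
    have : Continuous (fun z : E × ℝ => (z.1, -z.2)) := by fun_prop
    simpa using this.tendsto (x₀, 0)
  filter_upwards [h₃, hneg.eventually h₃, hodd] with z hz hz' he
  have h2 : (2 : ℝ) • F z = (2 : ℝ) • (z.2 • G₂ (z.1, z.2 ^ 2)) := by
    rw [two_smul, two_smul]
    nth_rewrite 1 [← neg_neg (F z)]
    rw [← he, hz', hz]
    simp only [even_two, Even.neg_pow, neg_smul]
    abel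
  exact smul_right_injective B (two_ne_zero : (2 : ℝ) ≠ 0) h2

end Module

section Algebra

variable {E B : Type*} [NormedAddCommGroup E] [NormedSpace ℝ E]
  [NormedCommRing B] [NormedAlgebra ℝ B] {x₀ : E}

theorem mul {F F' : E × ℝ → B} (h : AnalyticSplitAt F x₀) (h' : AnalyticSplitAt F' x₀) :
    AnalyticSplitAt (fun z => F z * F' z) x₀ := by
  obtain ⟨G₁, G₂, h₁, h₂, h₃⟩ := h
  obtain ⟨G₁', G₂', h₁', h₂', h₃'⟩ := h'
  refine ⟨fun z => G₁ z * G₁' z + z.2 • (G₂ z * G₂' z), fun z => G₁ z * G₂' z + G₂ z * G₁' z,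
    (h₁.mul h₁').add (analyticAt_snd.smul (h₂.mul h₂')), (h₁.mul h₂').add (h₂.mul h₁'), ?_⟩
  filter_upwards [h₃, h₃'] with z hz hz'
  rw [hz, hz']
  simp only [Algebra.smul_def, map_pow]
  ring

theorem pow {F : E × ℝ → B} (h : AnalyticSplitAt F x₀) (n : ℕ) :
    AnalyticSplitAt (fun z => F z ^ n) x₀ := by
  induction n with
  | zero => simpa using const (E := E) (x₀ := x₀) (1 : B)
  | succ n ih => simpa only [pow_succ] using ih.mul h

theorem ringInverse [CompleteSpace B] {F : E × ℝ → B} (h : AnalyticSplitAt F x₀)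
    (hu : IsUnit (F (x₀, 0))) : AnalyticSplitAt (fun z => Ring.inverse (F z)) x₀ := by
  obtain ⟨G₁, G₂, h₁, h₂, h₃⟩ := h
  have hF0 : F (x₀, 0) = G₁ (x₀, 0) := by simpa using h₃.self_of_nhds
  have hN : AnalyticAt ℝ (fun z : E × ℝ => G₁ z ^ 2 - z.2 • G₂ z ^ 2) (x₀, 0) :=
    (h₁.pow 2).sub (analyticAt_snd.smul (h₂.pow 2))
  have hN0 : IsUnit (G₁ (x₀, 0) ^ 2 - (0 : ℝ) • G₂ (x₀, 0) ^ 2) := by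
    rw [hF0] at hu
    simpa using hu
  obtain ⟨w, hw⟩ := hN0
  have hI : AnalyticAt ℝ (fun z : E × ℝ => Ring.inverse (G₁ z ^ 2 - z.2 • G₂ z ^ 2)) (x₀, 0) :=
    AnalyticAt.fun_comp (g := Ring.inverse) (by
      have := analyticAt_inverse (𝕜 := ℝ) w
      rw [hw] at this
      exact this) hN
  refine ⟨fun z => G₁ z * Ring.inverse (G₁ z ^ 2 - z.2 • G₂ z ^ 2),
    fun z => -(G₂ z * Ring.inverse (G₁ z ^ 2 - z.2 • G₂ z ^ 2)), h₁.mul hI, (h₂.mul hI).neg, ?_⟩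
  have hunit : ∀ᶠ z in 𝓝 (x₀, (0 : ℝ)), IsUnit (G₁ z ^ 2 - z.2 • G₂ z ^ 2) :=
    hN.continuousAt.eventually (Units.isOpen.mem_nhds (show IsUnit _ from ⟨w, hw⟩))
  have hsq : Tendsto (fun z : E × ℝ => (z.1, z.2 ^ 2)) (𝓝 (x₀, 0)) (𝓝 (x₀, 0)) := by
    have : Continuous (fun z : E × ℝ => (z.1, z.2 ^ 2)) := by fun_prop
    simpa using this.tendsto (x₀, 0)
  filter_upwards [h₃, hsq.eventually hunit] with z hz hz'
  set a := G₁ (z.1, z.2 ^ 2)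
  set b := G₂ (z.1, z.2 ^ 2)
  set N := a ^ 2 - z.2 ^ 2 • b ^ 2 with hNdef
  have hfac : F z * (a - z.2 • b) = N := by
    rw [hz, hNdef]
    simp only [Algebra.smul_def, map_pow]
    ring
  have h1 : F z * ((a - z.2 • b) * Ring.inverse N) = 1 := by
    rw [← mul_assoc, hfac, Ring.mul_inverse_cancel _ hz']
  have hinv : Ring.inverse (F z) = (a - z.2 • b) * Ring.inverse N := by
    have hFu : IsUnit (F z) := IsUnit.of_mul_eq_one _ h1
    calc Ring.inverse (F z) = Ring.inverse (F z) * (F z * ((a - z.2 • b) * Ring.inverse N)) := by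
          rw [h1, mul_one]
      _ = _ := by rw [← mul_assoc, Ring.inverse_mul_cancel _ hFu, one_mul]
  rw [hinv, sub_mul, smul_mul_assoc, smul_neg, sub_eq_add_neg]

end Algebra

end AnalyticSplitAt

theorem eq_of_eventually_sq {B : Type*} [NormedAddCommGroup B] [NormedSpace ℝ B]
    {s : ℝ} (hs : s ≤ 0) {h₁ h₂ : ℝ → B} (ha₁ : AnalyticOnNhd ℝ h₁ (Set.Icc s 0))
    (ha₂ : AnalyticOnNhd ℝ h₂ (Set.Icc s 0)) (he : ∀ᶠ r in 𝓝 (0 : ℝ), h₁ (r ^ 2) = h₂ (r ^ 2)) :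
    h₁ s = h₂ s := by
  refine ha₁.eqOn_of_preconnected_of_frequently_eq ha₂ isPreconnected_Icc
    (Set.right_mem_Icc.mpr hs) ?_ (Set.left_mem_Icc.mpr hs)
  have hsqrt : Tendsto Real.sqrt (𝓝[>] 0) (𝓝 0) := by
    simpa using (Real.continuous_sqrt.tendsto 0).mono_left nhdsWithin_le_nhds
  have h : ∀ᶠ t in 𝓝[>] (0 : ℝ), h₁ t = h₂ t := by
    filter_upwards [hsqrt.eventually he, self_mem_nhdsWithin] with t ht ht0
    rwa [Real.sq_sqrt (le_of_lt ht0)] at ht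
  exact h.frequently.filter_mono (nhdsWithin_mono _ fun t ht => ne_of_gt ht)

theorem exists_analyticOnNhd_comp_sq {E B : Type*} [NormedAddCommGroup E] [NormedSpace ℝ E]
    [NormedAddCommGroup B] [NormedSpace ℝ B] [CompleteSpace B] {D : Set (E × ℝ)} {H : E × ℝ → B}
    (hrefl : ∀ z ∈ D, (z.1, -z.2) ∈ D) (heven : ∀ z ∈ D, H (z.1, -z.2) = H z)
    (hana : ∀ z ∈ D, z.2 ≠ 0 → AnalyticAt ℝ H z)
    (hloc : ∀ x, (x, (0 : ℝ)) ∈ D → ∃ G : E × ℝ → B, AnalyticAt ℝ G (x, 0) ∧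
      ∀ᶠ z in 𝓝 (x, (0 : ℝ)), H z = G (z.1, z.2 ^ 2)) :
    ∃ G : E × ℝ → B, AnalyticOnNhd ℝ G ((fun z : E × ℝ => (z.1, z.2 ^ 2)) '' D) ∧
      ∀ z ∈ D, H z = G (z.1, z.2 ^ 2) := by
  classical
  let P : E → ℝ → (ℝ → B) → Prop := fun x s h =>
    AnalyticOnNhd ℝ h (Set.Icc s 0) ∧ ∀ᶠ r in 𝓝 (0 : ℝ), h (r ^ 2) = H (x, r)
  let G : E × ℝ → B := fun z =>
    if 0 ≤ z.2 then H (z.1, √z.2) else if h : ∃ h, P z.1 z.2 h then h.choose z.2 else 0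
  have habs : ∀ z ∈ D, (z.1, |z.2|) ∈ D ∧ H (z.1, |z.2|) = H z := by
    intro z hz
    rcases abs_cases z.2 with ⟨h, -⟩ | ⟨h, -⟩ <;> rw [h]
    · exact ⟨hz, rfl⟩
    · exact ⟨hrefl z hz, heven z hz⟩
  refine ⟨G, ?_, ?_⟩
  · rintro _ ⟨⟨x, r⟩, hz, rfl⟩
    by_cases hr : r = 0
    · subst hr
      obtain ⟨g, hg, hHg⟩ := hloc x hz
      simp only [ne_eq, OfNat.ofNat_ne_zero, not_false_eq_true, zero_pow]
      refine hg.congr ?_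
      obtain ⟨ρ, hρ, hgρ⟩ := Metric.eventually_nhds_iff_ball.mp hg.eventually_analyticAt
      obtain ⟨δ, hδ, hHδ⟩ := Metric.eventually_nhds_iff_ball.mp hHg
      have hmem : ∀ᶠ w in 𝓝 (x, (0 : ℝ)), w ∈ ball (x, (0 : ℝ)) ρ ∧ w.1 ∈ ball x δ ∧ √w.2 < δ := by
        refine Filter.Eventually.and (ball_mem_nhds _ hρ) (Filter.Eventually.and ?_ ?_)
        · exact continuousAt_fst.eventually_mem (ball_mem_nhds x hδ)
        · have : ContinuousAt (fun w : E × ℝ => √w.2) (x, 0) := by fun_prop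
          exact this.eventually (gt_mem_nhds (by simpa using hδ))
      filter_upwards [hmem] with ⟨y, s⟩ ⟨h1, h2, h3⟩
      rw [← ball_prod_same, Set.mem_prod, Real.ball_eq_Ioo] at h1
      have hball : ∀ t, |t| < δ → (y, t) ∈ ball (x, (0 : ℝ)) δ := by
        intro t ht
        rw [← ball_prod_same]
        exact ⟨h2, by simpa using ht⟩
      by_cases hs : 0 ≤ s
      · have := hHδ (y, √s) (hball _ (by rwa [abs_of_nonneg (Real.sqrt_nonneg s)]))
        simp only [Real.sq_sqrt hs] at this
        simp only [G, if_pos hs, this]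
      · have hP : P y s (fun t => g (y, t)) := by
          refine ⟨fun t ht => ?_, ?_⟩
          · refine AnalyticAt.fun_comp (g := g) (f := fun t => (y, t)) (hgρ _ ?_)
              (analyticAt_const.prod analyticAt_id)
            rw [← ball_prod_same, Set.mem_prod, Real.ball_eq_Ioo]
            exact ⟨h1.1, by have := h1.2.1; have := ht.1; simp only at *; linarith,
              by have := ht.2; simp only at *; linarith⟩
          · filter_upwards [ball_mem_nhds (0 : ℝ) hδ] with t ht
            exact (hHδ (y, t) (hball t (by simpa using ht))).symm
        have hex : ∃ h, P y s h := ⟨_, hP⟩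
        simp only [G, if_neg hs, dif_pos hex]
        refine eq_of_eventually_sq (h₁ := fun t => g (y, t)) (le_of_not_ge hs) hP.1
          hex.choose_spec.1 ?_
        filter_upwards [hP.2, hex.choose_spec.2] with t ht ht'
        rw [ht, ht']
    · have hpos : (0 : ℝ) < r ^ 2 := by positivity
      have hsq : AnalyticAt ℝ Real.sqrt (r ^ 2) :=
        (Real.contDiffAt_sqrt (n := ⊤) hpos.ne').analyticAt
      have hA : AnalyticAt ℝ (fun w : E × ℝ => (w.1, √w.2)) (x, r ^ 2) :=
        analyticAt_fst.prod (AnalyticAt.fun_comp (g := Real.sqrt) (f := Prod.snd) hsq analyticAt_snd)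
      have hH : AnalyticAt ℝ H ((fun w : E × ℝ => (w.1, √w.2)) (x, r ^ 2)) := by
        simp only [Real.sqrt_sq_eq_abs]
        exact hana _ (habs _ hz).1 (by simpa using hr)
      refine (AnalyticAt.fun_comp_of_eq hH hA rfl).congr ?_
      have : ∀ᶠ w : E × ℝ in 𝓝 (x, r ^ 2), 0 < w.2 :=
        continuousAt_snd.eventually (lt_mem_nhds hpos)
      filter_upwards [this] with w hw
      simp only [G, if_pos hw.le]
  · intro z hz
    simp only [G, if_pos (sq_nonneg z.2), Real.sqrt_sq_eq_abs]
    exact (habs z hz).2.symm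

/-- The second-order operator `∑ᵢ ∂ᵢ²` on scalar functions on `ι → ℝ`. -/
def lapPi {ι : Type*} [Fintype ι] [DecidableEq ι] (Ψ : (ι → ℝ) → ℝ) (X : ι → ℝ) : ℝ :=
  ∑ i, fderiv ℝ (fun Y => fderiv ℝ Ψ Y (Pi.single i 1)) X (Pi.single i 1)

/-- `U` is harmonic on `Ω` in the sense of distributions. -/
def WeaklyHarmonicOn {ι : Type*} [Fintype ι] [DecidableEq ι] {B : Type*} [NormedAddCommGroup B]
    [NormedSpace ℝ B] (U : (ι → ℝ) → B) (Ω : Set (ι → ℝ)) : Prop :=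
  ∀ Ψ : (ι → ℝ) → ℝ, ContDiff ℝ 2 Ψ → HasCompactSupport Ψ → tsupport Ψ ⊆ Ω →
    ∫ X, lapPi Ψ X • U X = 0

section Kernel

variable {ι : Type*} [Fintype ι]

/-- The squared Euclidean distance on `ι → ℝ`. -/
def sqDist (X Y : ι → ℝ) : ℝ := ∑ i, (X i - Y i) ^ 2

theorem sqDist_nonneg (X Y : ι → ℝ) : 0 ≤ sqDist X Y :=
  Finset.sum_nonneg fun _ _ => sq_nonneg _

theorem sqDist_pos {X Y : ι → ℝ} (h : X ≠ Y) : 0 < sqDist X Y := by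
  obtain ⟨i, hi⟩ := Function.ne_iff.mp h
  exact Finset.sum_pos' (fun _ _ => sq_nonneg _)
    ⟨i, Finset.mem_univ i, by have := sub_ne_zero.mpr hi; positivity⟩

theorem contDiff_sqDist {n : WithTop ℕ∞} (Y : ι → ℝ) : ContDiff ℝ n fun X => sqDist X Y := by
  unfold sqDist
  fun_prop

theorem norm_sq_le_sqDist_zero (X : ι → ℝ) : ‖X‖ ^ 2 ≤ sqDist X 0 := by
  have h : ‖X‖ ≤ √(sqDist X 0) := by
    refine (pi_norm_le_iff_of_nonneg (Real.sqrt_nonneg _)).mpr fun i => ?_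
    rw [Real.norm_eq_abs]
    refine Real.abs_le_sqrt ?_
    have := Finset.single_le_sum (f := fun i => (X i - (0 : ι → ℝ) i) ^ 2)
      (fun _ _ => sq_nonneg _) (Finset.mem_univ i)
    simpa [sqDist] using this
  calc ‖X‖ ^ 2 ≤ √(sqDist X 0) ^ 2 := by gcongr
    _ = sqDist X 0 := Real.sq_sqrt (sqDist_nonneg _ _)

theorem hasFDerivAt_sqDist (X Y : ι → ℝ) :
    HasFDerivAt (fun X => sqDist X Y)
      (∑ i, (2 * (X i - Y i)) • (ContinuousLinearMap.proj i : (ι → ℝ) →L[ℝ] ℝ)) X := by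
  unfold sqDist
  refine HasFDerivAt.fun_sum fun i _ => ?_
  have h : HasFDerivAt (fun X : ι → ℝ => X i - Y i)
      (ContinuousLinearMap.proj i : (ι → ℝ) →L[ℝ] ℝ) X :=
    (ContinuousLinearMap.proj i : (ι → ℝ) →L[ℝ] ℝ).hasFDerivAt.sub_const (Y i)
  simpa using h.pow 2

theorem hasFDerivAt_inv_sqDist_pow {η : ℝ} (hη : 0 < η) (n : ℕ) (X Y : ι → ℝ) :
    HasFDerivAt (fun X => ((sqDist X Y + η) ^ n)⁻¹)
      ((-(n * ((sqDist X Y + η) ^ (n + 1))⁻¹)) •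
        ∑ i, (2 * (X i - Y i)) • (ContinuousLinearMap.proj i : (ι → ℝ) →L[ℝ] ℝ)) X := by
  have hpos : 0 < sqDist X Y + η := add_pos_of_nonneg_of_pos (sqDist_nonneg _ _) hη
  have h1 : HasDerivAt (fun t : ℝ => (t ^ n)⁻¹) (-(n * ((sqDist X Y + η) ^ (n + 1))⁻¹))
      (sqDist X Y + η) := by
    have := (hasDerivAt_pow n (sqDist X Y + η)).fun_inv (pow_ne_zero n hpos.ne')
    have heq : -(n * (sqDist X Y + η) ^ (n - 1)) / ((sqDist X Y + η) ^ n) ^ 2 =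
        -(n * ((sqDist X Y + η) ^ (n + 1))⁻¹) := by
      rcases n with _ | n
      · simp
      · rw [Nat.add_sub_cancel]
        field_simp
        ring
    rwa [heq] at this
  exact HasDerivAt.comp_hasFDerivAt (h₂ := fun t : ℝ => (t ^ n)⁻¹) X h1
    ((hasFDerivAt_sqDist X Y).add_const η)

theorem contDiff_inv_sqDist_pow {η : ℝ} (hη : 0 < η) (n : ℕ) {k : WithTop ℕ∞} (Y : ι → ℝ) :
    ContDiff ℝ k (fun X => ((sqDist X Y + η) ^ n)⁻¹) :=
  (((contDiff_sqDist Y).add contDiff_const).pow n).inv fun X =>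
    (pow_pos (add_pos_of_nonneg_of_pos (sqDist_nonneg X Y) hη) n).ne'

variable [DecidableEq ι]

theorem fderiv_inv_sqDist_pow {η : ℝ} (hη : 0 < η) (n : ℕ) (X Y : ι → ℝ) (i : ι) :
    fderiv ℝ (fun X => ((sqDist X Y + η) ^ n)⁻¹) X (Pi.single i 1) =
      -(2 * n) * (X i - Y i) * ((sqDist X Y + η) ^ (n + 1))⁻¹ := by
  rw [(hasFDerivAt_inv_sqDist_pow hη n X Y).fderiv]
  simp [Pi.single_apply]
  ring

theorem lapPi_inv_sqDist_pow {η : ℝ} (hη : 0 < η) {n : ℕ} (hn : Fintype.card ι = 2 * (n + 1))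
    (X Y : ι → ℝ) :
    lapPi (fun X => ((sqDist X Y + η) ^ n)⁻¹) X =
      -(4 * n * (n + 1)) * (η * ((sqDist X Y + η) ^ (n + 2))⁻¹) := by
  have hpos : 0 < sqDist X Y + η := add_pos_of_nonneg_of_pos (sqDist_nonneg _ _) hη
  have h : ∀ i, fderiv ℝ (fun Z => fderiv ℝ (fun X => ((sqDist X Y + η) ^ n)⁻¹) Z (Pi.single i 1))
      X (Pi.single i 1) = -(2 * n) * ((sqDist X Y + η) ^ (n + 1))⁻¹ +
        4 * n * (n + 1) * ((sqDist X Y + η) ^ (n + 2))⁻¹ * (X i - Y i) ^ 2 := by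
    intro i
    simp only [fderiv_inv_sqDist_pow hη]
    have h1 : HasFDerivAt (fun X : ι → ℝ => -(2 * (n : ℝ)) * (X i - Y i))
        ((-(2 * (n : ℝ))) • (ContinuousLinearMap.proj i : (ι → ℝ) →L[ℝ] ℝ)) X :=
      ((ContinuousLinearMap.proj i : (ι → ℝ) →L[ℝ] ℝ).hasFDerivAt.sub_const (Y i)).const_mul _
    have h2 := h1.fun_mul (hasFDerivAt_inv_sqDist_pow hη (n + 1) X Y)
    rw [h2.fderiv]
    simp [Pi.single_apply]
    ring
  unfold lapPi
  simp only [h]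
  rw [Finset.sum_add_distrib, ← Finset.mul_sum Finset.univ (fun i => (X i - Y i) ^ 2),
    Finset.sum_const, Finset.card_univ, hn, ← sqDist]
  simp only [nsmul_eq_mul]
  push_cast
  field_simp
  ring

theorem lapPi_mul {χ N : (ι → ℝ) → ℝ} (hχ : ContDiff ℝ 2 χ) (hN : ContDiff ℝ 2 N) (X : ι → ℝ) :
    lapPi (fun X => χ X * N X) X = χ X * lapPi N X + (lapPi χ X * N X +
      ∑ i, 2 * (fderiv ℝ χ X (Pi.single i 1) * fderiv ℝ N X (Pi.single i 1))) := by
  have hχ1 : Differentiable ℝ χ := hχ.differentiable (by norm_num)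
  have hN1 : Differentiable ℝ N := hN.differentiable (by norm_num)
  have hd : ∀ {f : (ι → ℝ) → ℝ}, ContDiff ℝ 2 f → ∀ i,
      Differentiable ℝ (fun X => fderiv ℝ f X (Pi.single i 1)) := fun hf i =>
    ((hf.fderiv_right (m := 1) (by norm_num)).clm_apply contDiff_const).differentiable (by norm_num)
  unfold lapPi
  rw [Finset.mul_sum, Finset.sum_mul, ← Finset.sum_add_distrib, ← Finset.sum_add_distrib]
  refine Finset.sum_congr rfl fun i _ => ?_
  have h1 : (fun Y => fderiv ℝ (fun X => χ X * N X) Y (Pi.single i 1)) = fun Y =>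
      χ Y * fderiv ℝ N Y (Pi.single i 1) + N Y * fderiv ℝ χ Y (Pi.single i 1) := by
    funext Y
    rw [fderiv_fun_mul (hχ1 Y) (hN1 Y)]
    simp
  rw [h1, fderiv_fun_add ((hχ1 X).fun_mul (hd hN i X)) ((hN1 X).fun_mul (hd hχ i X)),
    fderiv_fun_mul (hχ1 X) (hd hN i X), fderiv_fun_mul (hN1 X) (hd hχ i X)]
  simp
  ring

theorem continuous_lapPi {χ : (ι → ℝ) → ℝ} (hχ : ContDiff ℝ 2 χ) : Continuous (lapPi χ) := by
  unfold lapPi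
  refine continuous_finsetSum _ fun i _ => ?_
  exact ((((hχ.fderiv_right (m := 1) (by norm_num)).clm_apply contDiff_const).continuous_fderiv
    (by norm_num)).clm_apply continuous_const)

theorem tsupport_lapPi_subset (χ : (ι → ℝ) → ℝ) : tsupport (lapPi χ) ⊆ tsupport χ := by
  refine closure_minimal (fun X hX => ?_) (isClosed_tsupport χ)
  by_contra h
  refine hX (Finset.sum_eq_zero fun i _ => ?_)
  have h1 := tsupport_fderiv_apply_subset ℝ (f := χ) (Pi.single i (1 : ℝ))
  have h2 := tsupport_fderiv_apply_subset ℝ (f := fun Y => fderiv ℝ χ Y (Pi.single i 1))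
    (Pi.single i (1 : ℝ))
  exact image_eq_zero_of_notMem_tsupport
    (f := fun Z => fderiv ℝ (fun Y => fderiv ℝ χ Y (Pi.single i 1)) Z (Pi.single i 1))
    fun h' => h (h1 (h2 h'))

end Kernel

section Peak

variable {ι : Type*} [Fintype ι]

theorem integrable_inv_sqDist_pow {n : ℕ} (hn : Fintype.card ι = 2 * (n + 1)) :
    Integrable (fun X : ι → ℝ => ((sqDist X 0 + 1) ^ (n + 2))⁻¹) := by
  have h := integrable_rpow_neg_one_add_norm_sq (E := ι → ℝ) (μ := volume)
    (r := 2 * ((n + 2 : ℕ) : ℝ)) (by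
      rw [Module.finrank_pi, hn]
      push_cast
      linarith)
  refine h.mono' (contDiff_inv_sqDist_pow (k := 0) one_pos (n + 2)
    0).continuous.aestronglyMeasurable (ae_of_all _ fun X => ?_)
  have hX := norm_sq_le_sqDist_zero X
  rw [Real.norm_of_nonneg (by have := sqDist_nonneg X 0; positivity),
    show -(2 * ((n + 2 : ℕ) : ℝ)) / 2 = -((n + 2 : ℕ) : ℝ) by ring,
    Real.rpow_neg (by positivity), Real.rpow_natCast]
  refine inv_anti₀ (by positivity) (pow_le_pow_left₀ (by positivity) ?_ _)
  linarith

theorem tendsto_norm_pow_mul_inv_sqDist_pow (n : ℕ) :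
    Tendsto (fun X : ι → ℝ => ‖X‖ ^ (2 * (n + 1)) * ((sqDist X 0 + 1) ^ (n + 2))⁻¹)
      (Bornology.cobounded (ι → ℝ)) (𝓝 0) := by
  have hlim : Tendsto (fun X : ι → ℝ => (‖X‖ ^ 2)⁻¹) (Bornology.cobounded (ι → ℝ)) (𝓝 0) :=
    ((tendsto_pow_atTop (α := ℝ) two_ne_zero).comp
      (tendsto_norm_cobounded_atTop (E := ι → ℝ))).inv_tendsto_atTop
  refine squeeze_zero (fun X => ?_) (fun X => ?_) hlim
  · exact mul_nonneg (pow_nonneg (norm_nonneg X) _)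
      (inv_nonneg.mpr (pow_nonneg (add_nonneg (sqDist_nonneg X 0) zero_le_one) _))
  · have hs : 0 < sqDist X 0 + 1 := add_pos_of_nonneg_of_pos (sqDist_nonneg X 0) one_pos
    have hle : ‖X‖ ^ 2 ≤ sqDist X 0 + 1 := (norm_sq_le_sqDist_zero X).trans (by linarith)
    rcases eq_or_ne X 0 with rfl | hX
    · simp
    have hX' : 0 < ‖X‖ ^ 2 := pow_pos (norm_pos_iff.mpr hX) 2
    generalize sqDist X 0 + 1 = s at hs hle
    rw [pow_mul]
    generalize ‖X‖ ^ 2 = t at hX' hle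
    rw [mul_inv_le_iff₀ (pow_pos hs _), ← div_eq_inv_mul, le_div_iff₀ hX', ← pow_succ]
    exact pow_le_pow_left₀ hX'.le hle _

theorem tendsto_integral_inv_sqDist_pow_smul {B : Type*} [NormedAddCommGroup B] [NormedSpace ℝ B]
    [CompleteSpace B] {n : ℕ} (hn : Fintype.card ι = 2 * (n + 1)) :
    ∃ C : ℝ, 0 < C ∧ ∀ (W : (ι → ℝ) → B), Continuous W → HasCompactSupport W → ∀ Y,
      Tendsto (fun c : ℝ => ∫ X, ((c ^ 2)⁻¹ * ((sqDist X Y + (c ^ 2)⁻¹) ^ (n + 2))⁻¹) • W X)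
        atTop (𝓝 (C • W Y)) := by
  have hint := integrable_inv_sqDist_pow (ι := ι) hn
  have hpos : ∀ X : ι → ℝ, 0 < ((sqDist X 0 + 1) ^ (n + 2))⁻¹ := fun X =>
    inv_pos.mpr (pow_pos (add_pos_of_nonneg_of_pos (sqDist_nonneg X 0) one_pos) _)
  obtain ⟨C, hC⟩ : ∃ C, C = ∫ X : ι → ℝ, ((sqDist X 0 + 1) ^ (n + 2))⁻¹ := ⟨_, rfl⟩
  have hCpos : 0 < C := by
    rw [hC, integral_pos_iff_support_of_nonneg (fun X => (hpos X).le) hint]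
    have : Function.support (fun X : ι → ℝ => ((sqDist X 0 + 1) ^ (n + 2))⁻¹) = Set.univ :=
      Set.eq_univ_of_forall fun X => (hpos X).ne'
    rw [this]
    exact isOpen_univ.measure_pos _ Set.univ_nonempty
  refine ⟨C, hCpos, fun W hW hWs Y => ?_⟩
  have hdecay : Tendsto (fun X : ι → ℝ => ‖X‖ ^ Module.finrank ℝ (ι → ℝ) *
      (C⁻¹ * ((sqDist X 0 + 1) ^ (n + 2))⁻¹)) (Bornology.cobounded (ι → ℝ)) (𝓝 0) := by
    rw [Module.finrank_pi, hn]
    simpa [mul_left_comm] using (tendsto_norm_pow_mul_inv_sqDist_pow (ι := ι) n).const_mul C⁻¹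
  have h : Tendsto (fun c : ℝ => ∫ X, (c ^ Module.finrank ℝ (ι → ℝ) *
      (C⁻¹ * ((sqDist (c • (Y - X)) 0 + 1) ^ (n + 2))⁻¹)) • W X) atTop (𝓝 (W Y)) :=
    tendsto_integral_comp_smul_smul_of_integrable' (μ := (volume : Measure (ι → ℝ)))
    (fun X => mul_nonneg (inv_nonneg.mpr hCpos.le) (hpos X).le)
    (by rw [integral_const_mul, ← hC, inv_mul_cancel₀ hCpos.ne']) hdecay
    (hW.integrable_of_hasCompactSupport hWs) hW.continuousAt
  refine (h.const_smul C).congr' ?_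
  filter_upwards [eventually_gt_atTop 0] with c hc
  rw [← integral_smul]
  refine integral_congr_ae (ae_of_all _ fun X => ?_)
  have hs : sqDist (c • (Y - X)) 0 = c ^ 2 * sqDist X Y := by
    simp only [sqDist, Finset.mul_sum]
    refine Finset.sum_congr rfl fun i _ => ?_
    simp
    ring
  simp only [smul_smul, hs, Module.finrank_pi, hn]
  congr 1
  have h0 := sqDist_nonneg X Y
  have h1 : sqDist X Y + (c ^ 2)⁻¹ = (c ^ 2 * sqDist X Y + 1) * (c ^ 2)⁻¹ := by
    field_simp
  have hd : c ^ 2 ≠ 0 := (pow_pos hc 2).ne'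
  rw [h1, pow_mul, mul_pow, mul_inv, inv_pow, inv_inv, pow_succ (c ^ 2) (n + 1)]
  field_simp

end Peak

section Representation

theorem exists_clm_eq_integral_smul {E B : Type*} [TopologicalSpace E] [MeasurableSpace E]
    [OpensMeasurableSpace E] [T2Space E] {μ : Measure E} [IsFiniteMeasureOnCompacts μ]
    [NormedAddCommGroup B] [NormedSpace ℝ B] {K : Set E} [CompactSpace K] (hK : IsCompact K)
    {W : E → B} (hW : ContinuousOn W K) (hW0 : ∀ x ∉ K, W x = 0) :
    ∃ ℓ : C(K, ℝ) →L[ℝ] B, ∀ (h : C(K, ℝ)) (g : E → ℝ), (∀ x : K, h x = g x) →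
      ℓ h = ∫ x, g x • W x ∂μ := by
  have hint : ∀ h : C(K, ℝ), Integrable (fun x : K => h x • W x) (μ.comap Subtype.val) := by
    intro h
    have hc : ContinuousOn (fun x => Function.extend Subtype.val h 0 x • W x) K := by
      refine ContinuousOn.smul ?_ hW
      rw [continuousOn_iff_continuous_domRestrict]
      convert h.continuous with x
      ext x
      simp
    have := (integrableOn_iff_comap_subtypeVal hK.measurableSet).mp
      (hc.integrableOn_compact (μ := μ) hK)
    refine this.congr (ae_of_all _ fun x => ?_)
    simp
  have hWi : Integrable (fun x : K => W x) (μ.comap Subtype.val) := by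
    simpa using hint 1
  refine ⟨LinearMap.mkContinuous
    { toFun := fun h => ∫ x : K, h x • W x ∂(μ.comap Subtype.val)
      map_add' := fun h h' => ?_
      map_smul' := fun c h => ?_ } (∫ x : K, ‖W x‖ ∂(μ.comap Subtype.val)) fun h => ?_,
    fun h g hg => ?_⟩
  · simp only [ContinuousMap.add_apply, add_smul]
    exact integral_add (hint h) (hint h')
  · simp only [ContinuousMap.smul_apply, smul_assoc, RingHom.id_apply]
    exact integral_smul c _
  · simp only [LinearMap.coe_mk, AddHom.coe_mk]
    rw [mul_comm, ← integral_const_mul]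
    refine norm_integral_le_of_norm_le (hWi.norm.const_mul _) (ae_of_all _ fun x => ?_)
    rw [norm_smul]
    exact mul_le_mul_of_nonneg_right (h.norm_coe_le_norm x) (norm_nonneg _)
  · simp only [LinearMap.mkContinuous_apply, LinearMap.coe_mk, AddHom.coe_mk, hg]
    rw [integral_subtype_comap hK.measurableSet (fun x => g x • W x)]
    exact setIntegral_eq_integral_of_forall_compl_eq_zero fun x hx => by simp [hW0 x hx]

theorem ContinuousMap.ringInverse_apply {K : Type*} [TopologicalSpace K] [CompactSpace K]
    (s : C(K, ℝ)) (hs : ∀ x, s x ≠ 0) (x : K) : Ring.inverse s x = (s x)⁻¹ := by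
  have hu : IsUnit s := (ContinuousMap.isUnit_iff_forall_ne_zero s).mpr hs
  have h := congrArg (fun t : C(K, ℝ) => t x) (Ring.inverse_mul_cancel s hu)
  exact eq_inv_of_mul_eq_one_left (by simpa using h)

theorem integral_smul_add_add_sum_smul {E B ι : Type*} [Fintype ι] [MeasurableSpace E] {μ : Measure E}
    [NormedAddCommGroup B] [NormedSpace ℝ B] {a b : E → B} {d : ι → E → B} (ha : Integrable a μ)
    (hb : Integrable b μ) (hd : ∀ i, Integrable (d i) μ) (s t : ℝ) :
    ∫ x, (s • a x + (b x + ∑ i, t • d i x)) ∂μ =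
      s • ∫ x, a x ∂μ + (∫ x, b x ∂μ + ∑ i, t • ∫ x, d i x ∂μ) := by
  have hs : Integrable (fun x => ∑ i, t • d i x) μ :=
    integrable_finsetSum _ fun i _ => (hd i).smul t
  have hbs : Integrable (fun x => b x + ∑ i, t • d i x) μ := hb.add hs
  have has : Integrable (fun x => s • a x) μ := ha.smul s
  rw [integral_add has hbs, integral_add hb hs, integral_smul,
    integral_finsetSum _ fun i _ => by exact (hd i).smul t]
  simp only [integral_smul]

variable {ι : Type*} [Fintype ι] [DecidableEq ι]

/-- The function `X ↦ X i - Y i` on `K`. -/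
def coordSub (K : Set (ι → ℝ)) (i : ι) (Y : ι → ℝ) : C(K, ℝ) :=
  ⟨fun X => (X : ι → ℝ) i - Y i,
    ((continuous_apply i).comp continuous_subtype_val).sub continuous_const⟩

theorem integral_regularized_eq {B : Type*} [NormedAddCommGroup B] [NormedSpace ℝ B]
    {n : ℕ} (hn : Fintype.card ι = 2 * (n + 1)) {Ω : Set (ι → ℝ)} {U : (ι → ℝ) → B}
    (hU : ContinuousOn U Ω) (hΩ : IsOpen Ω) (hharm : WeaklyHarmonicOn U Ω) {χ : (ι → ℝ) → ℝ}
    (hχ : ContDiff ℝ 2 χ) (hχs : HasCompactSupport χ) (hχΩ : tsupport χ ⊆ Ω) {η : ℝ}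
    (hη : 0 < η) (Y : ι → ℝ) :
    (4 * n * (n + 1) : ℝ) • ∫ X, (η * ((sqDist X Y + η) ^ (n + 2))⁻¹) • χ X • U X =
      (∫ X, ((sqDist X Y + η) ^ n)⁻¹ • lapPi χ X • U X) +
      ∑ i, (-(4 * n) : ℝ) • ∫ X, ((X i - Y i) * ((sqDist X Y + η) ^ (n + 1))⁻¹) •
        fderiv ℝ χ X (Pi.single i 1) • U X := by
  have hcut : ∀ ψ : (ι → ℝ) → ℝ, Continuous ψ → tsupport ψ ⊆ tsupport χ →
      ∀ g : (ι → ℝ) → ℝ, Continuous g → Integrable fun X => g X • ψ X • U X := by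
    intro ψ hψ hs g hg
    have hcs : HasCompactSupport ψ := hχs.mono' ((subset_tsupport ψ).trans hs)
    have hc : Continuous fun X => ψ X • U X := by
      refine ContinuousOn.continuous_of_tsupport_subset (hψ.continuousOn.smul hU) hΩ ?_
      exact (tsupport_smul_subset_left ψ U).trans (hs.trans hχΩ)
    exact (hg.smul hc).integrable_of_hasCompactSupport (hcs.smul_right.smul_left)
  have hk : ∀ m, Continuous fun X => ((sqDist X Y + η) ^ m)⁻¹ := fun m =>
    (contDiff_inv_sqDist_pow (k := 0) hη m Y).continuous
  have hN := contDiff_inv_sqDist_pow (k := 2) hη n Y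
  have h0 := hharm (fun X => χ X * ((sqDist X Y + η) ^ n)⁻¹) (hχ.mul hN) hχs.mul_right
    ((tsupport_mul_subset_left).trans hχΩ)
  have hi1 := hcut χ hχ.continuous subset_rfl (fun X => η * ((sqDist X Y + η) ^ (n + 2))⁻¹)
    ((hk _).const_mul _)
  have hi2 := hcut (lapPi χ) (continuous_lapPi hχ) (tsupport_lapPi_subset χ) _ (hk n)
  have hi3 : ∀ i, Integrable fun X => ((X i - Y i) * ((sqDist X Y + η) ^ (n + 1))⁻¹) •
        fderiv ℝ χ X (Pi.single i 1) • U X := fun i =>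
    hcut (fun X => fderiv ℝ χ X (Pi.single i 1))
      ((hχ.continuous_fderiv (by norm_num)).clm_apply continuous_const)
      (tsupport_fderiv_apply_subset ℝ _) _
      (((continuous_apply i).sub continuous_const).mul (hk _))
  have heq : ∀ X, lapPi (fun X => χ X * ((sqDist X Y + η) ^ n)⁻¹) X • U X =
      (-(4 * n * (n + 1) : ℝ)) • ((η * ((sqDist X Y + η) ^ (n + 2))⁻¹) • χ X • U X) +
      (((sqDist X Y + η) ^ n)⁻¹ • lapPi χ X • U X +
      ∑ i, (-(4 * n) : ℝ) • (((X i - Y i) * ((sqDist X Y + η) ^ (n + 1))⁻¹) •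
        fderiv ℝ χ X (Pi.single i 1) • U X)) := by
    intro X
    rw [lapPi_mul hχ hN, lapPi_inv_sqDist_pow hη hn]
    simp only [fderiv_inv_sqDist_pow hη, smul_smul, ← Finset.sum_smul, ← add_smul]
    congr 1
    congr 1
    · ring
    · congr 1
      · ring
      · exact Finset.sum_congr rfl fun i _ => by ring
  simp only [heq] at h0
  rw [integral_smul_add_add_sum_smul hi1 hi2 hi3] at h0
  rw [neg_smul, neg_add_eq_zero] at h0
  exact h0

end Representation

section Kernel

variable {ι : Type*} [Fintype ι] [DecidableEq ι]

theorem exists_clm_regularized_eq {B : Type*} [NormedAddCommGroup B] [NormedSpace ℝ B]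
    {n : ℕ} (hn : Fintype.card ι = 2 * (n + 1)) {Ω : Set (ι → ℝ)} {U : (ι → ℝ) → B}
    (hU : ContinuousOn U Ω) (hΩ : IsOpen Ω) (hharm : WeaklyHarmonicOn U Ω) {χ : (ι → ℝ) → ℝ}
    (hχ : ContDiff ℝ 2 χ) (hχs : HasCompactSupport χ) (hχΩ : tsupport χ ⊆ Ω)
    {K : Set (ι → ℝ)} [CompactSpace K] (hK : IsCompact K) (hKΩ : K ⊆ Ω)
    (hχK : ∀ X ∉ K, fderiv ℝ χ =ᶠ[𝓝 X] 0) :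
    ∃ (ℓ₀ : C(K, ℝ) →L[ℝ] B) (ℓ : ι → C(K, ℝ) →L[ℝ] B), ∀ (Y : ι → ℝ) (η : ℝ), 0 < η →
      (4 * n * (n + 1) : ℝ) • ∫ X, (η * ((sqDist X Y + η) ^ (n + 2))⁻¹) • χ X • U X =
      ℓ₀ (Ring.inverse (∑ i, coordSub K i Y ^ 2 + algebraMap ℝ _ η) ^ n) +
      ∑ i, ℓ i (coordSub K i Y *
        Ring.inverse (∑ i, coordSub K i Y ^ 2 + algebraMap ℝ _ η) ^ (n + 1)) := by
  have hd : ∀ X ∉ K, ∀ i, (fun X => fderiv ℝ χ X (Pi.single i 1)) =ᶠ[𝓝 X] 0 := by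
    intro X hX i
    filter_upwards [hχK X hX] with Z hZ
    simp [hZ]
  obtain ⟨ℓ₀, hℓ₀⟩ := exists_clm_eq_integral_smul (μ := volume) hK
    (W := fun X => lapPi χ X • U X) ((continuous_lapPi hχ).continuousOn.smul (hU.mono hKΩ))
    fun X hX => by
      have : lapPi χ X = 0 := Finset.sum_eq_zero fun i _ => by
        rw [(hd X hX i).fderiv_eq]
        simp
      rw [this, zero_smul]
  have hℓ : ∀ i, ∃ ℓ : C(K, ℝ) →L[ℝ] B, ∀ (h : C(K, ℝ)) (g : (ι → ℝ) → ℝ),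
      (∀ x : K, h x = g x) → ℓ h = ∫ X, g X • fderiv ℝ χ X (Pi.single i 1) • U X := fun i =>
    exists_clm_eq_integral_smul (μ := volume) hK
      (((hχ.continuous_fderiv (by norm_num)).clm_apply continuous_const).continuousOn.smul
        (hU.mono hKΩ))
      fun X hX => by simpa using congrArg (· • U X) (hd X hX i).self_of_nhds
  choose ℓ hℓ using hℓ
  refine ⟨ℓ₀, fun i => (-(4 * n) : ℝ) • ℓ i, fun Y η hη => ?_⟩
  have hs : ∀ X : K, (∑ i, coordSub K i Y ^ 2 + algebraMap ℝ _ η) X = sqDist X Y + η := by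
    intro X
    simp [coordSub, sqDist]
  have hpos : ∀ X : K, (∑ i, coordSub K i Y ^ 2 + algebraMap ℝ _ η) X ≠ 0 := by
    intro X
    rw [hs]
    exact (add_pos_of_nonneg_of_pos (sqDist_nonneg _ _) hη).ne'
  have hinv : ∀ X : K, Ring.inverse (∑ i, coordSub K i Y ^ 2 + algebraMap ℝ _ η) X =
      (sqDist X Y + η)⁻¹ := fun X => by
    rw [ContinuousMap.ringInverse_apply _ hpos, hs]
  rw [integral_regularized_eq hn hU hΩ hharm hχ hχs hχΩ hη Y]
  congr 1
  · rw [hℓ₀]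
    intro X
    rw [ContinuousMap.pow_apply, hinv, inv_pow]
  · refine Finset.sum_congr rfl fun i _ => ?_
    rw [smul_apply, hℓ i]
    intro X
    rw [ContinuousMap.mul_apply, ContinuousMap.pow_apply, hinv, inv_pow]
    rfl

theorem exists_clm_representation {B : Type*} [NormedAddCommGroup B] [NormedSpace ℝ B]
    [CompleteSpace B] {n : ℕ} (hn : Fintype.card ι = 2 * (n + 1)) (hn0 : n ≠ 0)
    {Ω : Set (ι → ℝ)} {U : (ι → ℝ) → B} (hU : ContinuousOn U Ω) (hΩ : IsOpen Ω)
    (hharm : WeaklyHarmonicOn U Ω) {Y₀ : ι → ℝ} (hY₀ : Y₀ ∈ Ω) :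
    ∃ (K : Set (ι → ℝ)) (_ : CompactSpace K) (ℓ₀ : C(K, ℝ) →L[ℝ] B)
      (ℓ : ι → C(K, ℝ) →L[ℝ] B), IsUnit (∑ i, coordSub K i Y₀ ^ 2) ∧ ∀ᶠ Y in 𝓝 Y₀,
      U Y = ℓ₀ (Ring.inverse (∑ i, coordSub K i Y ^ 2) ^ n) +
      ∑ i, ℓ i (coordSub K i Y * Ring.inverse (∑ i, coordSub K i Y ^ 2) ^ (n + 1)) := by
  obtain ⟨R, hR, hRΩ⟩ := Metric.nhds_basis_closedBall.mem_iff.mp (hΩ.mem_nhds hY₀)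
  let χ : ContDiffBump Y₀ := ⟨R / 2, R, by linarith, by linarith⟩
  have hχs : tsupport χ = closedBall Y₀ R := χ.tsupport_eq
  have hχΩ : tsupport χ ⊆ Ω := hχs ▸ hRΩ
  set K : Set (ι → ℝ) := closedBall Y₀ R \ ball Y₀ (R / 2) with hKdef
  have hK : IsCompact K := (isCompact_closedBall _ _).diff isOpen_ball
  have : CompactSpace K := isCompact_iff_compactSpace.mp hK
  have hχK : ∀ X ∉ K, fderiv ℝ χ =ᶠ[𝓝 X] 0 := by
    intro X hX
    by_cases hXb : X ∈ ball Y₀ (R / 2)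
    · filter_upwards [isOpen_ball.mem_nhds hXb] with Z hZ
      have : (χ : (ι → ℝ) → ℝ) =ᶠ[𝓝 Z] fun _ => 1 :=
        χ.eventuallyEq_one_of_mem_ball hZ
      simp [this.fderiv_eq]
    · have hXs : X ∉ tsupport (fderiv ℝ χ) := fun h =>
        hX ⟨hχs ▸ tsupport_fderiv_subset ℝ h, hXb⟩
      exact notMem_tsupport_iff_eventuallyEq.mp hXs
  obtain ⟨ℓ₀, ℓ, hℓ⟩ := exists_clm_regularized_eq hn hU hΩ hharm χ.contDiff
    χ.hasCompactSupport hχΩ hK (fun X hX => hRΩ hX.1) hχK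
  obtain ⟨C, hC, hpeak⟩ := tendsto_integral_inv_sqDist_pow_smul (ι := ι) (B := B) hn
  have hunit : ∀ Y ∈ ball Y₀ (R / 2), IsUnit (∑ i, coordSub K i Y ^ 2) := by
    intro Y hY
    refine (ContinuousMap.isUnit_iff_forall_ne_zero _).mpr fun X => ?_
    have hne : (X : ι → ℝ) ≠ Y := fun h => X.2.2 (h ▸ hY)
    simpa [coordSub, sqDist] using (sqDist_pos hne).ne'
  have hW : Continuous fun X => χ X • U X :=
    ContinuousOn.continuous_of_tsupport_subset (χ.continuous.continuousOn.smul hU) hΩ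
      ((tsupport_smul_subset_left _ U).trans hχΩ)
  have hc : 4 * n * (n + 1) * C ≠ 0 := by positivity
  refine ⟨K, this, (4 * n * (n + 1) * C)⁻¹ • ℓ₀, fun i => (4 * n * (n + 1) * C)⁻¹ • ℓ i,
    hunit Y₀ (mem_ball_self (by linarith)), ?_⟩
  filter_upwards [ball_mem_nhds Y₀ (by linarith : 0 < R / 2)] with Y hY
  have h1 := (hpeak _ hW χ.hasCompactSupport.smul_right Y).const_smul (4 * n * (n + 1) : ℝ)
  have hη : Tendsto (fun c : ℝ => (c ^ 2)⁻¹) atTop (𝓝 0) :=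
    (tendsto_pow_atTop two_ne_zero).inv_tendsto_atTop
  have hinv : Tendsto (fun c : ℝ => Ring.inverse (∑ i, coordSub K i Y ^ 2 +
      algebraMap ℝ C(K, ℝ) (c ^ 2)⁻¹)) atTop (𝓝 (Ring.inverse (∑ i, coordSub K i Y ^ 2))) := by
    obtain ⟨u, hu⟩ := hunit Y hY
    have h2 := NormedRing.inverse_continuousAt u
    rw [hu] at h2
    refine h2.tendsto.comp ?_
    have h3 := ((algebraMapCLM ℝ C(K, ℝ)).continuous.tendsto 0).comp hη
    simpa using h3.const_add (∑ i, coordSub K i Y ^ 2)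
  have h4 : Tendsto (fun c : ℝ => ℓ₀ (Ring.inverse (∑ i, coordSub K i Y ^ 2 +
      algebraMap ℝ C(K, ℝ) (c ^ 2)⁻¹) ^ n) +
      ∑ i, ℓ i (coordSub K i Y * Ring.inverse (∑ i, coordSub K i Y ^ 2 +
        algebraMap ℝ C(K, ℝ) (c ^ 2)⁻¹) ^ (n + 1))) atTop
      (𝓝 (ℓ₀ (Ring.inverse (∑ i, coordSub K i Y ^ 2) ^ n) +
      ∑ i, ℓ i (coordSub K i Y * Ring.inverse (∑ i, coordSub K i Y ^ 2) ^ (n + 1)))) :=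
    ((ℓ₀.continuous.tendsto _).comp (hinv.pow n)).add (tendsto_finsetSum _ fun i _ =>
      ((ℓ i).continuous.tendsto _).comp ((hinv.pow (n + 1)).const_mul _))
  have h5 := tendsto_nhds_unique (h4.congr' ?_) h1
  · simp only [smul_apply, ← Finset.smul_sum, ← smul_add, h5]
    have hχY : χ Y = 1 := χ.one_of_mem_closedBall (ball_subset_closedBall hY)
    rw [hχY, one_smul, smul_smul, smul_smul, mul_assoc, inv_mul_cancel₀ hc, one_smul]
  · filter_upwards [eventually_gt_atTop 0] with c hc
    exact (hℓ Y _ (by positivity)).symm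

end Kernel

section Split

variable {ι : Type*} [Fintype ι] [DecidableEq ι]

theorem WeaklyHarmonicOn.analyticSplitAt {E B : Type*} [NormedAddCommGroup E] [NormedSpace ℝ E]
    [NormedAddCommGroup B] [NormedSpace ℝ B] [CompleteSpace B] {n : ℕ}
    (hn : Fintype.card ι = 2 * (n + 1)) (hn0 : n ≠ 0) {Ω : Set (ι → ℝ)} {U : (ι → ℝ) → B}
    (hharm : WeaklyHarmonicOn U Ω) (hU : ContinuousOn U Ω) (hΩ : IsOpen Ω) {T : E × ℝ → ι → ℝ}
    {x₀ : E} (hT : ∀ i, AnalyticSplitAt (fun z => T z i) x₀) (hx₀ : T (x₀, 0) ∈ Ω) :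
    AnalyticSplitAt (fun z => U (T z)) x₀ := by
  obtain ⟨K, hK, ℓ₀, ℓ, hunit, hrep⟩ := exists_clm_representation hn hn0 hU hΩ hharm hx₀
  have hTc : ContinuousAt T (x₀, 0) :=
    continuousAt_pi.mpr fun i => (hT i).analyticAt.continuousAt
  have hcoord : ∀ i, AnalyticSplitAt (fun z => coordSub K i (T z)) x₀ := by
    intro i
    refine ((AnalyticSplitAt.const (coordSub K i 0)).add
      ((hT i).clm_apply (-algebraMapCLM ℝ C(K, ℝ)))).congr (Eventually.of_forall fun z => ?_)
    ext X
    simp [coordSub, sub_eq_add_neg]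
  have hs : AnalyticSplitAt (fun z => ∑ i, coordSub K i (T z) ^ 2) x₀ :=
    AnalyticSplitAt.sum _ fun i _ => (hcoord i).pow 2
  have hinv := hs.ringInverse hunit
  exact (((hinv.pow n).clm_apply ℓ₀).add (AnalyticSplitAt.sum _ fun i _ =>
    (((hcoord i).mul (hinv.pow (n + 1))).clm_apply (ℓ i)))).congr (hTc.eventually hrep)

end Split

section CauchyRiemann

variable {E B : Type*} [NormedAddCommGroup E] [NormedAddCommGroup B] [NormedSpace ℝ B]
  {Ω : Set E} {ψ : E → ℝ} {U : E → B}

variable [MeasurableSpace E] [BorelSpace E] {μ : Measure E}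

theorem integrable_smul_of_tsupport_subset [IsFiniteMeasureOnCompacts μ] (hΩ : IsOpen Ω) (hψ : Continuous ψ)
    (hψs : HasCompactSupport ψ) (hψΩ : tsupport ψ ⊆ Ω) (hU : ContinuousOn U Ω) :
    Integrable (fun X => ψ X • U X) μ :=
  (ContinuousOn.continuous_of_tsupport_subset (hψ.continuousOn.smul hU) hΩ
    ((tsupport_smul_subset_left ψ U).trans hψΩ)).integrable_of_hasCompactSupport hψs.smul_right

variable [NormedSpace ℝ E] [FiniteDimensional ℝ E] [μ.IsAddHaarMeasure]

theorem integral_fderiv_smul_eq_neg (hΩ : IsOpen Ω) (hψ : ContDiff ℝ 1 ψ)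
    (hψs : HasCompactSupport ψ) (hψΩ : tsupport ψ ⊆ Ω) (hU : ContDiffOn ℝ 1 U Ω) (v : E) :
    ∫ X, fderiv ℝ ψ X v • U X ∂μ = -∫ X, ψ X • fderiv ℝ U X v ∂μ := by
  have hψ' : Continuous fun X => fderiv ℝ ψ X v :=
    (hψ.continuous_fderiv one_ne_zero).clm_apply continuous_const
  have hU' : ContinuousOn (fun X => fderiv ℝ U X v) Ω :=
    (hU.continuousOn_fderiv_of_isOpen hΩ le_rfl).clm_apply continuousOn_const
  have hsub := tsupport_fderiv_apply_subset ℝ (f := ψ) v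
  rw [integral_smul_fderiv_eq_neg_fderiv_smul_of_integrable, neg_neg]
  · exact integrable_smul_of_tsupport_subset hΩ hψ' (hψs.fderiv_apply ℝ v) (hsub.trans hψΩ)
      hU.continuousOn
  · exact integrable_smul_of_tsupport_subset hΩ hψ.continuous hψs hψΩ hU'
  · exact integrable_smul_of_tsupport_subset hΩ hψ.continuous hψs hψΩ hU.continuousOn
  · exact fun X _ => hψ.differentiable one_ne_zero X
  · exact fun X hX => (hU.differentiableOn one_ne_zero).differentiableAt
      (hΩ.mem_nhds (hψΩ hX))

theorem integral_snd_fderiv_smul_eq_neg (hΩ : IsOpen Ω) (hψ : ContDiff ℝ 2 ψ)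
    (hψs : HasCompactSupport ψ) (hψΩ : tsupport ψ ⊆ Ω) (hU : ContDiffOn ℝ 1 U Ω) (v w : E) :
    ∫ X, fderiv ℝ (fun Y => fderiv ℝ ψ Y v) X w • U X ∂μ =
      -∫ X, fderiv ℝ ψ X v • fderiv ℝ U X w ∂μ :=
  integral_fderiv_smul_eq_neg hΩ
    ((hψ.fderiv_right (m := 1) (by norm_num)).clm_apply contDiff_const) (hψs.fderiv_apply ℝ v)
    ((tsupport_fderiv_apply_subset ℝ v).trans hψΩ) hU w

theorem integral_fderiv_smul_fderiv_comm (hΩ : IsOpen Ω) (hψ : ContDiff ℝ 2 ψ)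
    (hψs : HasCompactSupport ψ) (hψΩ : tsupport ψ ⊆ Ω) (hU : ContDiffOn ℝ 1 U Ω) (v w : E) :
    ∫ X, fderiv ℝ ψ X v • fderiv ℝ U X w ∂μ = ∫ X, fderiv ℝ ψ X w • fderiv ℝ U X v ∂μ := by
  rw [← neg_inj, ← integral_snd_fderiv_smul_eq_neg hΩ hψ hψs hψΩ hU,
    ← integral_snd_fderiv_smul_eq_neg hΩ hψ hψs hψΩ hU]
  refine integral_congr_ae (ae_of_all _ fun X => ?_)
  have hd : DifferentiableAt ℝ (fderiv ℝ ψ) X :=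
    (hψ.fderiv_right (m := 1) (by norm_num)).differentiable one_ne_zero X
  have hsymm : IsSymmSndFDerivAt ℝ ψ X := hψ.contDiffAt.isSymmSndFDerivAt (by simp)
  have h : ∀ v w, fderiv ℝ (fun Y => fderiv ℝ ψ Y v) X w = fderiv ℝ (fderiv ℝ ψ) X w v := by
    intro v w
    rw [fderiv_clm_apply hd (differentiableAt_const v)]
    simp
  simp only [h]
  rw [hsymm.eq]

theorem integral_laplacian_smul_eq_zero_of_cauchyRiemann {κ A : Type*} [Fintype κ]
    [DecidableEq κ] [NormedRing A] [NormedAlgebra ℝ A] [CompleteSpace A] {U₁ U₂ : E → A}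
    {a b : κ → A} (hab : ∀ i j, b i * a j + b j * a i = if i = j then 2 else 0) {s : κ → E}
    {r : E} (hΩ : IsOpen Ω) (hU₁ : ContDiffOn ℝ 1 U₁ Ω) (hU₂ : ContDiffOn ℝ 1 U₂ Ω)
    (h₁ : ∀ X ∈ Ω, ∑ i, a i * fderiv ℝ U₁ X (s i) = fderiv ℝ U₂ X r)
    (h₂ : ∀ X ∈ Ω, ∑ i, b i * fderiv ℝ U₂ X (s i) = -fderiv ℝ U₁ X r)
    (hψ : ContDiff ℝ 2 ψ) (hψs : HasCompactSupport ψ) (hψΩ : tsupport ψ ⊆ Ω) :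
    ∑ i, ∫ X, fderiv ℝ (fun Y => fderiv ℝ ψ Y (s i)) X (s i) • U₁ X ∂μ +
      ∫ X, fderiv ℝ (fun Y => fderiv ℝ ψ Y r) X r • U₁ X ∂μ = 0 := by
  have hint : ∀ {W : E → A}, ContDiffOn ℝ 1 W Ω → ∀ v w,
      Integrable (fun X => fderiv ℝ ψ X v • fderiv ℝ W X w) μ := fun hW v w =>
    integrable_smul_of_tsupport_subset hΩ
      ((hψ.continuous_fderiv (by norm_num)).clm_apply continuous_const) (hψs.fderiv_apply ℝ v)
      ((tsupport_fderiv_apply_subset ℝ v).trans hψΩ)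
      ((hW.continuousOn_fderiv_of_isOpen hΩ le_rfl).clm_apply continuousOn_const)
  have hsum : ∀ {W : E → A}, ContDiffOn ℝ 1 W Ω → ∀ (c : κ → A) (R : E → A),
      (∀ X ∈ Ω, ∑ i, c i * fderiv ℝ W X (s i) = R X) → ∀ v,
      ∑ i, c i * ∫ X, fderiv ℝ ψ X v • fderiv ℝ W X (s i) ∂μ =
        ∫ X, fderiv ℝ ψ X v • R X ∂μ := by
    intro W hW c R hR v
    have hmul : ∀ i, c i * ∫ X, fderiv ℝ ψ X v • fderiv ℝ W X (s i) ∂μ =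
        ∫ X, c i * (fderiv ℝ ψ X v • fderiv ℝ W X (s i)) ∂μ := fun i =>
      ((ContinuousLinearMap.mul ℝ A (c i)).integral_comp_comm (hint hW v (s i))).symm
    simp only [hmul]
    have hi : ∀ i ∈ Finset.univ,
        Integrable (fun X => c i * (fderiv ℝ ψ X v • fderiv ℝ W X (s i))) μ := fun i _ =>
      (ContinuousLinearMap.mul ℝ A (c i)).integrable_comp (hint hW v (s i))
    rw [← integral_finsetSum _ hi]
    refine integral_congr_ae (ae_of_all _ fun X => ?_)
    by_cases hX : X ∈ Ω
    · simp only [mul_smul_comm, ← Finset.smul_sum, hR X hX]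
    · have h0 : fderiv ℝ ψ X v = 0 := image_eq_zero_of_notMem_tsupport
        (f := fun X => fderiv ℝ ψ X v) fun h =>
          hX (hψΩ (tsupport_fderiv_apply_subset ℝ v h))
      simp [h0]
  have hcomm := fun (W : E → A) (hW : ContDiffOn ℝ 1 W Ω) v w =>
    integral_fderiv_smul_fderiv_comm (μ := μ) hΩ hψ hψs hψΩ hW v w
  have h1 := fun v => hsum hU₁ a _ h₁ v
  have h2 := hsum hU₂ b _ h₂ r
  simp only [integral_snd_fderiv_smul_eq_neg hΩ hψ hψs hψΩ hU₁]
  rw [Finset.sum_neg_distrib, ← neg_add, neg_eq_zero]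
  simp only [smul_neg, integral_neg] at h2
  rw [← neg_eq_iff_eq_neg.mpr h2, ← sub_eq_add_neg, sub_eq_zero]
  simp only [hcomm U₂ hU₂ r, ← h1, Finset.mul_sum, ← mul_assoc]
  have key : (2 : ℝ) • ∑ i, ∑ j, b i * a j * ∫ X, fderiv ℝ ψ X (s i) • fderiv ℝ U₁ X (s j) ∂μ =
      (2 : ℝ) • ∑ i, ∫ X, fderiv ℝ ψ X (s i) • fderiv ℝ U₁ X (s i) ∂μ := by
    rw [two_smul]
    nth_rewrite 2 [Finset.sum_comm]
    rw [← Finset.sum_add_distrib, Finset.smul_sum]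
    refine Finset.sum_congr rfl fun i _ => ?_
    rw [← Finset.sum_add_distrib]
    simp only [fun j => hcomm U₁ hU₁ (s j) (s i), ← add_mul, hab]
    simp [two_mul, two_smul]
  exact (smul_right_injective A two_ne_zero key).symm

end CauchyRiemann

section Slice

/-- Coordinates for the slice `ℝ^{p+2}` together with `p + 2` auxiliary ones. -/
abbrev SlIndex (p : ℕ) : Type := Option (Fin (p + 1)) ⊕ Fin (p + 2)

/-- The projection onto the slice `ℝ^{p+2}` forgetting the auxiliary coordinates. -/
def slProj (p : ℕ) : (SlIndex p → ℝ) →L[ℝ] Sl p :=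
  (ContinuousLinearMap.pi fun i => ContinuousLinearMap.proj (Sum.inl (some i))).prod
    (ContinuousLinearMap.proj (Sum.inl none))

theorem card_slIndex (p : ℕ) : Fintype.card (SlIndex p) = 2 * ((p + 1) + 1) := by
  simp
  ring

variable {p : ℕ}

theorem slProj_single_some (i : Fin (p + 1)) :
    slProj p (Pi.single (Sum.inl (some i)) 1) = (Pi.single i 1, 0) := by
  refine Prod.ext (funext fun j => ?_) ?_
  · simp [slProj, Pi.single_apply]
  · simp [slProj]

theorem slProj_single_none : slProj p (Pi.single (Sum.inl none) 1) = (0, 1) := by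
  refine Prod.ext (funext fun j => ?_) ?_ <;> simp [slProj]

theorem slProj_single_inr (i : Fin (p + 2)) : slProj p (Pi.single (Sum.inr i) 1) = 0 := by
  refine Prod.ext (funext fun j => ?_) ?_ <;> simp [slProj]

theorem fderiv_comp_slProj {B : Type*} [NormedAddCommGroup B] [NormedSpace ℝ B] {F : Sl p → B}
    {X : SlIndex p → ℝ} (hF : DifferentiableAt ℝ F (slProj p X)) (v : SlIndex p → ℝ) :
    fderiv ℝ (fun X => F (slProj p X)) X v = fderiv ℝ F (slProj p X) (slProj p v) := by
  rw [fderiv_fun_comp X hF (slProj p).differentiableAt, ContinuousLinearMap.fderiv]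
  rfl

theorem weaklyHarmonicOn_comp_slProj {A : Type*} [NormedRing A] [NormedAlgebra ℝ A]
    [CompleteSpace A] {D : Set (Sl p)} (hD : IsOpen D) {F₁ F₂ : Sl p → A}
    (hF₁ : ContDiffOn ℝ 1 F₁ D) (hF₂ : ContDiffOn ℝ 1 F₂ D) {a b : Fin (p + 1) → A}
    (hab : ∀ i j, b i * a j + b j * a i = if i = j then 2 else 0)
    (h₁ : ∀ z ∈ D, ∑ i, a i * pdSl p i F₁ z = pdr p F₂ z)
    (h₂ : ∀ z ∈ D, ∑ i, b i * pdSl p i F₂ z = -pdr p F₁ z) :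
    WeaklyHarmonicOn (fun X => F₁ (slProj p X)) (slProj p ⁻¹' D) := by
  intro ψ hψ hψs hψΩ
  have hΩ : IsOpen (slProj p ⁻¹' D) := hD.preimage (slProj p).continuous
  have hU₁ : ContDiffOn ℝ 1 (fun X => F₁ (slProj p X)) (slProj p ⁻¹' D) :=
    hF₁.comp (slProj p).contDiff.contDiffOn fun X hX => hX
  have hU₂ : ContDiffOn ℝ 1 (fun X => F₂ (slProj p X)) (slProj p ⁻¹' D) :=
    hF₂.comp (slProj p).contDiff.contDiffOn fun X hX => hX
  have hd₁ : ∀ X ∈ slProj p ⁻¹' D, DifferentiableAt ℝ F₁ (slProj p X) := fun X hX =>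
    (hF₁.differentiableOn one_ne_zero).differentiableAt (hD.mem_nhds hX)
  have hd₂ : ∀ X ∈ slProj p ⁻¹' D, DifferentiableAt ℝ F₂ (slProj p X) := fun X hX =>
    (hF₂.differentiableOn one_ne_zero).differentiableAt (hD.mem_nhds hX)
  have hmain := integral_laplacian_smul_eq_zero_of_cauchyRiemann (μ := volume) hab
    (s := fun i => Pi.single (Sum.inl (some i)) (1 : ℝ)) (r := Pi.single (Sum.inl none) (1 : ℝ))
    hΩ hU₁ hU₂
    (fun X hX => by
      simp only [fderiv_comp_slProj (hd₁ X hX), fderiv_comp_slProj (hd₂ X hX),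
        slProj_single_some, slProj_single_none]
      exact h₁ _ hX)
    (fun X hX => by
      simp only [fderiv_comp_slProj (hd₁ X hX), fderiv_comp_slProj (hd₂ X hX),
        slProj_single_some, slProj_single_none]
      exact h₂ _ hX) hψ hψs hψΩ
  have haux : ∀ i : Fin (p + 2), ∫ X, fderiv ℝ (fun Y => fderiv ℝ ψ Y (Pi.single (Sum.inr i) 1)) X
      (Pi.single (Sum.inr i) 1) • F₁ (slProj p X) = 0 := by
    intro i
    rw [integral_snd_fderiv_smul_eq_neg hΩ hψ hψs hψΩ hU₁, neg_eq_zero]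
    refine integral_eq_zero_of_ae (ae_of_all _ fun X => ?_)
    by_cases hX : X ∈ slProj p ⁻¹' D
    · simp [fderiv_comp_slProj (hd₁ X hX), slProj_single_inr]
    · have h0 := image_eq_zero_of_notMem_tsupport
        (f := fun X => fderiv ℝ ψ X (Pi.single (Sum.inr i) 1)) fun h =>
          hX (hψΩ (tsupport_fderiv_apply_subset ℝ _ h))
      simp only [h0, zero_smul, Pi.zero_apply]
  have hint : ∀ j ∈ Finset.univ, Integrable fun X : SlIndex p → ℝ =>
      fderiv ℝ (fun Y => fderiv ℝ ψ Y (Pi.single j 1)) X (Pi.single j 1) • F₁ (slProj p X) := by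
    intro j _
    have hc : ContDiff ℝ 1 fun Y => fderiv ℝ ψ Y (Pi.single j 1) :=
      (hψ.fderiv_right (m := 1) (by norm_num)).clm_apply contDiff_const
    exact integrable_smul_of_tsupport_subset hΩ
      ((hc.continuous_fderiv one_ne_zero).clm_apply continuous_const)
      ((hψs.fderiv_apply ℝ _).fderiv_apply ℝ _)
      ((tsupport_fderiv_apply_subset ℝ _).trans
        ((tsupport_fderiv_apply_subset ℝ _).trans hψΩ)) hU₁.continuousOn
  simp only [lapPi, Finset.sum_smul]
  rw [integral_finsetSum _ hint, Fintype.sum_sum_type, Fintype.sum_option,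
    Finset.sum_eq_zero fun i _ => haux i, add_zero, add_comm]
  exact hmain

variable {q : ℕ} {A : Type*} [NormedRing A] [NormedAlgebra ℝ A] (ξ : A ≃ₐ[ℝ] Cl (p + q))

theorem gen_mul_gen_add (i j : Fin (p + q)) :
    gen p q ξ i * gen p q ξ j + gen p q ξ j * gen p q ξ i = if i = j then -2 else 0 := by
  have h : e (p + q) i * e (p + q) j + e (p + q) j * e (p + q) i =
      algebraMap ℝ _ (if i = j then -2 else 0) := by
    rw [e, e, CliffordAlgebra.ι_mul_ι_add_swap]
    congr 1
    simp only [QuadraticMap.polar, Qe, QuadraticMap.weightedSumSquares_apply]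
    rw [← Finset.sum_sub_distrib, ← Finset.sum_sub_distrib]
    split_ifs with hij
    · subst hij
      rw [Finset.sum_eq_single i]
      · simp; norm_num
      · intro k _ hk
        simp [hk]
      · simp
    · refine Finset.sum_eq_zero fun k _ => ?_
      by_cases hk : k = i
      · subst hk
        simp [hij]
      · simp [Pi.single_apply, hk]
  rw [gen, gen, ← map_mul, ← map_mul, ← map_add, h, AlgEquiv.commutes]
  split_ifs <;> simp [map_ofNat]

/-- The conjugated paravector basis `1, -e_1, …, -e_p`. -/
def εpConj (i : Fin (p + 1)) : A := Fin.cases (motive := fun _ => A) 1 (fun j => -eP p q ξ j) i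

theorem εp_zero : εp p q ξ 0 = 1 := by simp [εp]

theorem εp_succ (i : Fin p) : εp p q ξ i.succ = eP p q ξ i := by simp [εp, eP]

theorem eP_mul_eP_add (i j : Fin p) :
    eP p q ξ i * eP p q ξ j + eP p q ξ j * eP p q ξ i = if i = j then -2 else 0 := by
  rw [eP, eP, gen_mul_gen_add]
  simp [Fin.ext_iff]

theorem εpConj_mul_εp_add (i j : Fin (p + 1)) :
    εpConj ξ i * εp p q ξ j + εpConj ξ j * εp p q ξ i = if i = j then 2 else 0 := by
  refine Fin.cases ?_ (fun i => ?_) i <;> refine Fin.cases ?_ (fun j => ?_) j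
  · simp [εpConj, εp_zero, one_add_one_eq_two]
  · simp [εpConj, εp_zero, εp_succ, (Fin.succ_ne_zero _).symm]
  · simp [εpConj, εp_zero, εp_succ]
  · have h := congrArg Neg.neg (eP_mul_eP_add ξ i j)
    simp only [εpConj, Fin.cases_succ, εp_succ, Fin.succ_inj, neg_mul]
    rw [← neg_add, h]
    split_ifs <;> simp

theorem εp_mul_εpConj_add (i j : Fin (p + 1)) :
    εp p q ξ i * εpConj ξ j + εp p q ξ j * εpConj ξ i = if i = j then 2 else 0 := by
  refine Fin.cases ?_ (fun i => ?_) i <;> refine Fin.cases ?_ (fun j => ?_) j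
  · simp [εpConj, εp_zero, one_add_one_eq_two]
  · simp [εpConj, εp_zero, εp_succ, (Fin.succ_ne_zero _).symm]
  · simp [εpConj, εp_zero, εp_succ]
  · have h := congrArg Neg.neg (eP_mul_eP_add ξ i j)
    simp only [εpConj, Fin.cases_succ, εp_succ, Fin.succ_inj, mul_neg]
    rw [← neg_add, h]
    split_ifs <;> simp

theorem DPbar_eq_sum (F : Sl p → A) (z : Sl p) :
    DPbar p q ξ F z = ∑ i, εpConj ξ i * pdSl p i F z := by
  rw [Fin.sum_univ_succ]
  simp [DPbar, εpConj, sub_eq_add_neg]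

theorem weaklyHarmonicOn_of_crSystem [CompleteSpace A] {D : Set (Sl p)} (hD : IsOpen D)
    {F₁ F₂ : Sl p → A} (hF₁ : ContDiffOn ℝ 1 F₁ D) (hF₂ : ContDiffOn ℝ 1 F₂ D)
    (h : CRSystem p q ξ D F₁ F₂) :
    WeaklyHarmonicOn (fun X => F₁ (slProj p X)) (slProj p ⁻¹' D) ∧
      WeaklyHarmonicOn (fun X => F₂ (slProj p X)) (slProj p ⁻¹' D) := by
  have h₁ : ∀ z ∈ D, ∑ i, εp p q ξ i * pdSl p i F₁ z = pdr p F₂ z := fun z hz =>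
    sub_eq_zero.mp (h z hz).1
  have h₂ : ∀ z ∈ D, ∑ i, εpConj ξ i * pdSl p i F₂ z = -pdr p F₁ z := fun z hz => by
    rw [← DPbar_eq_sum]
    exact eq_neg_of_add_eq_zero_left (h z hz).2
  refine ⟨weaklyHarmonicOn_comp_slProj hD hF₁ hF₂ (εpConj_mul_εp_add ξ) h₁ h₂,
    weaklyHarmonicOn_comp_slProj (F₂ := -F₁) hD hF₂ hF₁.neg (εp_mul_εpConj_add ξ) ?_ ?_⟩
  · intro z hz
    rw [h₂ z hz]
    simp [pdr, fderiv_neg]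
  · intro z hz
    rw [← h₁ z hz, ← Finset.sum_neg_distrib]
    simp [pdSl, fderiv_neg]

theorem analyticSplitAt_of_crSystem [CompleteSpace A] {D : Set (Sl p)} (hD : IsOpen D)
    {F₁ F₂ : Sl p → A} (hF₁ : ContDiffOn ℝ 1 F₁ D) (hF₂ : ContDiffOn ℝ 1 F₂ D)
    (h : CRSystem p q ξ D F₁ F₂) {x₀ : Vp p} {r₀ : ℝ} (hz : (x₀, r₀) ∈ D) :
    AnalyticSplitAt (fun z : Vp p × ℝ => F₁ (z.1, r₀ + z.2)) x₀ ∧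
      AnalyticSplitAt (fun z : Vp p × ℝ => F₂ (z.1, r₀ + z.2)) x₀ := by
  let T : Vp p × ℝ → SlIndex p → ℝ := fun z =>
    Sum.elim (fun i => i.elim (r₀ + z.2) z.1) 0
  have hT : ∀ i, AnalyticSplitAt (fun z => T z i) x₀ := by
    rintro ((_ | i) | i)
    · simpa [T] using (AnalyticSplitAt.const r₀).add (AnalyticSplitAt.snd_smul (1 : ℝ))
    · exact AnalyticSplitAt.of_fst
        ((ContinuousLinearMap.proj i : (Vp p) →L[ℝ] ℝ).analyticAt x₀)
    · exact AnalyticSplitAt.const 0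
  have hTp : ∀ z, slProj p (T z) = (z.1, r₀ + z.2) := fun z => rfl
  have hΩ : IsOpen (slProj p ⁻¹' D) := hD.preimage (slProj p).continuous
  have hT₀ : T (x₀, 0) ∈ slProj p ⁻¹' D := by
    rw [Set.mem_preimage, hTp, add_zero]
    exact hz
  obtain ⟨h₁, h₂⟩ := weaklyHarmonicOn_of_crSystem ξ hD hF₁ hF₂ h
  have hc : ∀ {F : Sl p → A}, ContDiffOn ℝ 1 F D →
      ContinuousOn (fun X => F (slProj p X)) (slProj p ⁻¹' D) := fun hF =>
    hF.continuousOn.comp (slProj p).continuous.continuousOn fun X hX => hX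
  exact ⟨h₁.analyticSplitAt (card_slIndex p) p.succ_ne_zero (hc hF₁) hΩ hT hT₀,
    h₂.analyticSplitAt (card_slIndex p) p.succ_ne_zero (hc hF₂) hΩ hT hT₀⟩

end Slice

section Components

variable {p q : ℕ}

theorem analyticAt_of_analyticSplitAt_add {E B : Type*} [NormedAddCommGroup E] [NormedSpace ℝ E]
    [NormedAddCommGroup B] [NormedSpace ℝ B] {F : E × ℝ → B} {x₀ : E} {r₀ : ℝ}
    (h : AnalyticSplitAt (fun z : E × ℝ => F (z.1, r₀ + z.2)) x₀) : AnalyticAt ℝ F (x₀, r₀) := by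
  have ht : AnalyticAt ℝ (fun z : E × ℝ => (z.1, z.2 - r₀)) (x₀, r₀) :=
    analyticAt_fst.prod (analyticAt_snd.sub analyticAt_const)
  have hc := AnalyticAt.fun_comp_of_eq h.analyticAt ht (by simp)
  simpa using hc

theorem eventually_div_snd_eq {E B : Type*} [NormedAddCommGroup E] [NormedSpace ℝ E]
    [NormedAddCommGroup B] [NormedSpace ℝ B] [CompleteSpace B] {F G : E × ℝ → B} {x₀ : E}
    (hG : AnalyticAt ℝ G (x₀, 0)) (hF : ∀ᶠ z in 𝓝 (x₀, (0 : ℝ)), F z = z.2 • G (z.1, z.2 ^ 2)) :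
    ∀ᶠ z in 𝓝 (x₀, (0 : ℝ)),
      (if z.2 = 0 then fderiv ℝ F z (0, 1) else z.2⁻¹ • F z) = G (z.1, z.2 ^ 2) := by
  have hsq : AnalyticAt ℝ (fun z : E × ℝ => (z.1, z.2 ^ 2)) (x₀, 0) :=
    analyticAt_fst.prod (analyticAt_snd.pow 2)
  have hGs : AnalyticAt ℝ (fun z : E × ℝ => G (z.1, z.2 ^ 2)) (x₀, 0) :=
    AnalyticAt.fun_comp_of_eq hG hsq (by simp)
  filter_upwards [hF, hF.eventually_nhds, hGs.eventually_analyticAt] with z hz hz' hza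
  split_ifs with h0
  · rw [Filter.EventuallyEq.fderiv_eq (f₁ := F) hz',
      fderiv_fun_smul differentiableAt_snd hza.differentiableAt]
    simp [h0, fderiv_snd]
  · rw [hz, smul_smul, inv_mul_cancel₀ h0, one_smul]

theorem analyticAt_ωCl {A : Type*} [NormedRing A] [NormedAlgebra ℝ A] (ξ : A ≃ₐ[ℝ] Cl (p + q))
    (w : Vq q) : AnalyticAt ℝ (ωCl p q ξ) w := by
  unfold ωCl
  exact Finset.analyticAt_fun_sum _ fun j _ =>
    ((EuclideanSpace.proj j : Vq q →L[ℝ] ℝ).analyticAt w).smul analyticAt_const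

theorem ωCl_smul {A : Type*} [NormedRing A] [NormedAlgebra ℝ A] (ξ : A ≃ₐ[ℝ] Cl (p + q))
    (c : ℝ) (w : Vq q) : ωCl p q ξ (c • w) = c • ωCl p q ξ w := by
  simp [ωCl, Finset.smul_sum, smul_smul]

theorem mem_S_iff_norm (v : Vq q) : v ∈ S q ↔ ‖v‖ = 1 := by
  rw [S, Set.mem_ofPred_eq, ← EuclideanSpace.real_norm_sq_eq]
  exact pow_eq_one_iff_of_nonneg (norm_nonneg v) two_ne_zero

theorem mem_completion_iff (hq : 1 ≤ q) {D : Set (Sl p)} (hrefl : ReflInv p D) (x : V p q) :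
    x ∈ completion p q D ↔ (x.1, ‖x.2‖) ∈ D := by
  constructor
  · rintro ⟨z, hz, v, hv, rfl⟩
    have hnorm : ‖z.2 • v‖ = |z.2| := by
      rw [norm_smul, (mem_S_iff_norm v).mp hv, mul_one, Real.norm_eq_abs]
    rcases abs_choice z.2 with h | h
    · simpa [spt, hnorm, h] using hz
    · simpa [spt, hnorm, h] using hrefl z hz
  · intro hx
    by_cases h0 : x.2 = 0
    · refine ⟨_, hx, EuclideanSpace.single ⟨0, hq⟩ 1, (mem_S_iff_norm _).mpr (by simp), ?_⟩
      exact Prod.ext rfl (by simp [spt, h0])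
    · have hn : ‖x.2‖ ≠ 0 := norm_ne_zero_iff.mpr h0
      refine ⟨_, hx, ‖x.2‖⁻¹ • x.2, (mem_S_iff_norm _).mpr ?_, ?_⟩
      · rw [norm_smul, norm_inv, norm_norm, inv_mul_cancel₀ hn]
      · exact Prod.ext rfl (by simp [spt, smul_smul, hn])

theorem isOpen_completion (hq : 1 ≤ q) {D : Set (Sl p)} (hD : IsOpen D) (hrefl : ReflInv p D) :
    IsOpen (completion p q D) := by
  have h : completion p q D = (fun x : V p q => ((x.1, ‖x.2‖) : Sl p)) ⁻¹' D :=
    Set.ext fun x => mem_completion_iff hq hrefl x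
  rw [h]
  exact hD.preimage (by fun_prop)

end Components

/-- Proposition 3.5.  Every `f = F₁ + ωF₂ ∈ 𝒢𝒮ℛ(Ω_D)` has real analytic components
`F₁, F₂` on `D`, is real analytic on `Ω_D`, and there are real analytic `G₁, G₂`
with `F₁(𝐱_p, r) = G₁(𝐱_p, r²)`, `F₂(𝐱_p, r) = r G₂(𝐱_p, r²)` on `D`, so that
`f(𝐱_p + 𝐱_q) = G₁(𝐱_p, r²) + 𝐱_q G₂(𝐱_p, r²)` with `r = |𝐱_q|`. -/
theorem gsr_real_analytic
    (p q : ℕ) (hq : 1 ≤ q) {A : Type*} [NormedRing A] [NormedAlgebra ℝ A]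
    (ξ : A ≃ₐ[ℝ] Cl (p + q))
    (D : Set (Sl p)) (hD : IsDomain D) (hrefl : ReflInv p D)
    (f : V p q → A) (F1 F2 : Sl p → A)
    (hgsr : GSROnWith p q ξ D f F1 F2) :
    AnalyticOnNhd ℝ F1 D ∧ AnalyticOnNhd ℝ F2 D ∧
    AnalyticOnNhd ℝ f (completion p q D) ∧
    ∃ G1 G2 : Sl p → A,
      AnalyticOnNhd ℝ G1 ((fun z : Sl p => ((z.1, z.2 ^ 2) : Sl p)) '' D) ∧
      AnalyticOnNhd ℝ G2 ((fun z : Sl p => ((z.1, z.2 ^ 2) : Sl p)) '' D) ∧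
      (∀ z ∈ D, F1 z = G1 (z.1, z.2 ^ 2) ∧ F2 z = z.2 • G2 (z.1, z.2 ^ 2)) ∧
      (∀ z ∈ D, ∀ v ∈ S q,
        f (spt p q v z)
          = G1 (z.1, z.2 ^ 2) + ωCl p q ξ (z.2 • v) * G2 (z.1, z.2 ^ 2)) := by
  obtain ⟨⟨hpar, hf⟩, hF1, hF2, hCR⟩ := hgsr
  have : FiniteDimensional ℝ (Cl (p + q)) := finiteDimensional_cl (p + q)
  have : FiniteDimensional ℝ A := Module.Finite.equiv ξ.symm.toLinearEquiv
  have : CompleteSpace A := FiniteDimensional.complete ℝ A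
  have hDo : IsOpen D := hD.1
  have hsplit : ∀ (x : Vp p) (r : ℝ), (x, r) ∈ D → _ := fun x r hz =>
    analyticSplitAt_of_crSystem ξ hDo hF1 hF2 hCR hz
  have hA1 : AnalyticOnNhd ℝ F1 D := fun z hz =>
    analyticAt_of_analyticSplitAt_add (hsplit z.1 z.2 hz).1
  have hA2 : AnalyticOnNhd ℝ F2 D := fun z hz =>
    analyticAt_of_analyticSplitAt_add (hsplit z.1 z.2 hz).2
  obtain ⟨G1, hG1, hFG1⟩ := exists_analyticOnNhd_comp_sq (H := F1) hrefl
    (fun z hz => (hpar z hz).1) (fun z hz _ => hA1 z hz) fun x hx => by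
      refine AnalyticSplitAt.exists_of_even (by simpa using (hsplit x 0 hx).1) ?_
      filter_upwards [hDo.mem_nhds hx] with z hz using (hpar z hz).1
  have hodd0 : ∀ z ∈ D, z.2 = 0 → F2 z = 0 := fun z hz h0 => by
    have h := (hpar z hz).2
    rw [h0, neg_zero, ← h0] at h
    have h2 : (2 : ℝ) • F2 z = 0 := (two_smul ℝ _).trans (eq_neg_iff_add_eq_zero.mp h)
    exact (smul_eq_zero.mp h2).resolve_left two_ne_zero
  let H : Sl p → A := fun z => if z.2 = 0 then pdr p F2 z else z.2⁻¹ • F2 z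
  obtain ⟨G2, hG2, hFG2⟩ := exists_analyticOnNhd_comp_sq (H := H) hrefl
    (fun z hz => by
      by_cases h0 : z.2 = 0
      · rw [h0, neg_zero, ← h0]
      · simp [H, h0, (hpar z hz).2, inv_neg])
    (fun z hz h0 => by
      refine ((analyticAt_snd.inv h0).smul (hA2 z hz)).congr ?_
      filter_upwards [continuousAt_snd.eventually_ne h0] with y hy
      simp [H, hy])
    fun x hx => by
      obtain ⟨G, hG, hGe⟩ := AnalyticSplitAt.exists_of_odd (F := F2) (x₀ := x)
        (by simpa using (hsplit x 0 hx).2)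
        (by filter_upwards [hDo.mem_nhds hx] with z hz using (hpar z hz).2)
      exact ⟨G, hG, eventually_div_snd_eq hG hGe⟩
  have hcomp : ∀ z ∈ D, F1 z = G1 (z.1, z.2 ^ 2) ∧ F2 z = z.2 • G2 (z.1, z.2 ^ 2) := by
    intro z hz
    refine ⟨hFG1 z hz, ?_⟩
    by_cases h0 : z.2 = 0
    · rw [hodd0 z hz h0, h0, zero_smul]
    · rw [← hFG2 z hz]
      simp [H, h0, smul_smul]
  have hfG : ∀ z ∈ D, ∀ v ∈ S q, f (spt p q v z) =
      G1 (z.1, z.2 ^ 2) + ωCl p q ξ (z.2 • v) * G2 (z.1, z.2 ^ 2) := by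
    intro z hz v hv
    rw [hf z hz v hv, (hcomp z hz).1, (hcomp z hz).2, ωCl_smul, mul_smul_comm, smul_mul_assoc]
  refine ⟨hA1, hA2, fun x hx => ?_, G1, G2, hG1, hG2, hcomp, hfG⟩
  have hsum : AnalyticAt ℝ (fun y : V p q => ((y.1, ∑ j, y.2 j ^ 2) : Sl p)) x :=
    analyticAt_fst.prod (Finset.analyticAt_fun_sum _ fun j _ =>
      (((EuclideanSpace.proj j : Vq q →L[ℝ] ℝ).comp (ContinuousLinearMap.snd ℝ (Vp p)
        (Vq q))).analyticAt x).pow 2)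
  have hmem : ((x.1, ∑ j, x.2 j ^ 2) : Sl p) ∈ (fun z : Sl p => ((z.1, z.2 ^ 2) : Sl p)) '' D :=
    ⟨(x.1, ‖x.2‖), (mem_completion_iff hq hrefl x).mp hx, by
      simp [EuclideanSpace.real_norm_sq_eq]⟩
  have hω : AnalyticAt ℝ (fun y : V p q => ωCl p q ξ y.2) x :=
    AnalyticAt.fun_comp_of_eq (analyticAt_ωCl ξ x.2) analyticAt_snd rfl
  refine ((AnalyticAt.fun_comp_of_eq (hG1 _ hmem) hsum rfl).add
    (hω.mul (AnalyticAt.fun_comp_of_eq (hG2 _ hmem) hsum rfl))).congr ?_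
  filter_upwards [(isOpen_completion hq hDo hrefl).mem_nhds hx] with y hy
  obtain ⟨z, hz, v, hv, rfl⟩ := hy
  have hs : ∑ j, (z.2 • v) j ^ 2 = z.2 ^ 2 := by
    rw [← EuclideanSpace.real_norm_sq_eq, norm_smul, (mem_S_iff_norm v).mp hv, mul_one,
      Real.norm_eq_abs, sq_abs]
  rw [hfG z hz v hv]
  simp only [Pi.add_apply, Pi.mul_apply, spt, hs]
end
end

section
/- Let f(𝐱) = F₁(𝐱') + ωF₂(𝐱') ∈ 𝒢𝒮ℛ(Ω_D) and define A₀ = F₁, B₀ = F₂ and, for k ≥ 1, A_k = (1/r)∂_r A_{k−1} and B_k = ∂_r( B_{k−1}/r ). Then for every k ≥ 0 the following system holds on D \ ℝ^{p+1}: D_{𝐱_p} A_k(𝐱') − ∂_r B_k(𝐱') = (2k/r) B_k(𝐱') and \overline{D}_{𝐱_p} B_k(𝐱') + ∂_r A_k(𝐱') = 0. -/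
/-!
Common framework for generalized partial-slice monogenic functions
(Xu–Sabadini, "On the Fueter-Sce theorem for generalized partial-slice
monogenic functions").

The real Clifford algebra `ℝ_{p+q}` is formalized as the Mathlib Clifford
algebra of the negative-definite quadratic form on `ℝ^{p+q}`; since Mathlib
provides no canonical norm on it, all analytic statements are phrased for an
arbitrary normed real algebra `A` together with an `ℝ`-algebra isomorphism
`ξ : A ≃ₐ[ℝ] Cl (p+q)`.  A point of `ℝ^{p+q+1}` is a pair
`(𝐱_p, 𝐱_q) : (Fin (p+1) → ℝ) × EuclideanSpace ℝ (Fin q)`, and a point of a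
slice `ℝ^{p+2}` is a pair `(𝐱_p, r)`.
-/

noncomputable section

open Filter Topology MeasureTheory Metric
open scoped Nat RealInnerProductSpace

open GPS

namespace GPS

section RadialAverages

open scoped ContDiff

variable {E G : Type*} [NormedAddCommGroup E] [NormedSpace ℝ E]
  [NormedAddCommGroup G] [NormedSpace ℝ G]
  {B : E →L[ℝ] E →L[ℝ] ℝ} {η : E → ℝ} {F : E → G}

theorem continuous_fderiv_sub_smul (hF : ContDiff ℝ 1 F) (x : E) (δ : ℝ) (v : E) :
    Continuous fun y => fderiv ℝ F (x - δ • y) v := by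
  have := hF.continuous_fderiv one_ne_zero
  fun_prop

variable [MeasurableSpace E] [BorelSpace E] (μ : Measure E) [μ.IsAddHaarMeasure]

/-- The first moment of `∂_v F` in the direction `w` against the weight `η`, at scale `δ`
around `x`. -/
def gradMoment (B : E →L[ℝ] E →L[ℝ] ℝ) (η : E → ℝ) (F : E → G) (x : E) (δ : ℝ) (v w : E) : G :=
  ∫ y, (B w y * η y) • fderiv ℝ F (x - δ • y) v ∂μ

theorem integrable_moment_smul {H : E → G} (hη : Continuous η) (hηs : HasCompactSupport η)
    (hH : Continuous H) (w : E) : Integrable (fun y => (B w y * η y) • H y) μ := by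
  refine Continuous.integrable_of_hasCompactSupport (by fun_prop) ?_
  exact HasCompactSupport.smul_right (HasCompactSupport.mul_left hηs)

/-- For a radial even weight the matrix of first moments of a gradient is symmetric. -/
theorem gradMoment_comm [FiniteDimensional ℝ E] (hB : ∀ v w, B v w = B w v) (hη : ContDiff ℝ 1 η)
    (hηs : HasCompactSupport η) (heven : ∀ y, η (-y) = η y)
    (hrad : ∀ y v w, B w y * fderiv ℝ η y v = B v y * fderiv ℝ η y w)
    (hF : ContDiff ℝ 1 F) (x : E) (δ : ℝ) (v w : E) :
    gradMoment μ B η F x δ v w = gradMoment μ B η F x δ w v := by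
  rcases eq_or_ne δ 0 with rfl | hδ
  · have hodd : ∀ v w, gradMoment μ B η F x 0 v w = 0 := by
      intro v w
      have h := integral_neg_eq_self (fun y => (B w y * η y) • fderiv ℝ F x v) μ
      simp only [map_neg, heven, neg_mul, neg_smul, integral_neg] at h
      have := IsAddTorsionFree.of_isTorsionFree ℝ G
      simpa [gradMoment] using self_eq_neg.1 h.symm
    rw [hodd, hodd]
  · have hH : ∀ y, HasFDerivAt (fun y => F (x - δ • y))
        ((fderiv ℝ F (x - δ • y)).comp (-(δ • ContinuousLinearMap.id ℝ E))) y := by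
      intro y
      have h1 : HasFDerivAt (fun y : E => x - δ • y) (-(δ • ContinuousLinearMap.id ℝ E)) y :=
        ((hasFDerivAt_id y).const_smul δ).const_sub x
      exact ((hF.differentiable one_ne_zero _).hasFDerivAt).comp y h1
    have hθ : ∀ w y, HasFDerivAt (fun y => B w y * η y)
        (B w y • fderiv ℝ η y + η y • B w) y := fun w y =>
      (B w).hasFDerivAt.mul (hη.differentiable one_ne_zero y).hasFDerivAt
    have hcont : Continuous fun y => F (x - δ • y) := by
      have := hF.continuous
      fun_prop
    have hη' : ∀ v, Continuous fun y => fderiv ℝ η y v := fun v => by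
      have := hη.continuous_fderiv one_ne_zero
      fun_prop
    have key : ∀ v w, δ • gradMoment μ B η F x δ v w
        = ∫ y, (B w y * fderiv ℝ η y v + η y * B w v) • F (x - δ • y) ∂μ := by
      intro v w
      have h := integral_smul_fderiv_eq_neg_fderiv_smul_of_integrable (μ := μ)
        (f := fun y => B w y * η y) (g := fun y => F (x - δ • y)) (v := v) ?_ ?_ ?_ ?_ ?_
      · simp only [(hH _).fderiv, (hθ _ _).fderiv] at h
        simp [integral_neg, smul_comm _ δ, integral_smul] at h
        rw [gradMoment, h]
      · simp only [(hθ _ _).fderiv]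
        refine Continuous.integrable_of_hasCompactSupport ?_ ?_
        · have := hη' v
          have := hη.continuous
          simp only [add_apply, smul_apply, smul_eq_mul]
          fun_prop
        · refine HasCompactSupport.smul_right ?_
          exact (hηs.fderiv_apply (𝕜 := ℝ) v).mul_left.add hηs.mul_right
      · simp only [(hH _).fderiv]
        refine integrable_moment_smul μ hη.continuous hηs ?_ w
        have := hF.continuous_fderiv one_ne_zero
        simp only [ContinuousLinearMap.comp_apply]
        fun_prop
      · exact integrable_moment_smul μ hη.continuous hηs hcont w
      · exact fun y _ => (hθ w y).differentiableAt
      · exact fun y _ => (hH y).differentiableAt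
    refine smul_right_injective G hδ ?_
    simp only [key, hrad _ v w, hB w v]

theorem hasDerivAt_average (hη : Continuous η) (hηs : HasCompactSupport η)
    (hF : ContDiff ℝ 1 F) (hFs : HasCompactSupport F) (x : E) (δ : ℝ) :
    HasDerivAt (fun δ : ℝ => ∫ y, η y • F (x - δ • y) ∂μ)
      (∫ y, η y • fderiv ℝ F (x - δ • y) (-y) ∂μ) δ := by
  have hF' := hF.continuous_fderiv one_ne_zero
  have hFc := hF.continuous
  obtain ⟨C, hC⟩ := hF'.bounded_above_of_compact_support (hFs.fderiv (𝕜 := ℝ))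
  refine (hasDerivAt_integral_of_dominated_loc_of_deriv_le (μ := μ)
    (F := fun (δ : ℝ) y => η y • F (x - δ • y))
    (F' := fun (δ : ℝ) y => η y • fderiv ℝ F (x - δ • y) (-y))
    (bound := fun y => ‖η y‖ * (C * ‖y‖)) univ_mem ?_ ?_ ?_ ?_ ?_ ?_).2
  · refine Eventually.of_forall fun δ => ?_
    exact (Continuous.integrable_of_hasCompactSupport (by fun_prop)
      hηs.smul_right).aestronglyMeasurable
  · exact Continuous.integrable_of_hasCompactSupport (by fun_prop) hηs.smul_right
  · exact (Continuous.integrable_of_hasCompactSupport (by fun_prop)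
      hηs.smul_right).aestronglyMeasurable
  · refine Eventually.of_forall fun y δ _ => ?_
    rw [norm_smul]
    gcongr
    simpa using (fderiv ℝ F (x - δ • y)).le_of_opNorm_le (hC _) (-y)
  · exact Continuous.integrable_of_hasCompactSupport (by fun_prop) hηs.norm.mul_right
  · refine Eventually.of_forall fun y δ _ => ?_
    have h1 : HasDerivAt (fun δ : ℝ => x - δ • y) (-y) δ := by
      simpa using ((hasDerivAt_id δ).smul_const y).const_sub x
    exact (((hF.differentiable one_ne_zero _).hasFDerivAt).comp_hasDerivAt δ h1).const_smul (η y)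

/-- If the traces of the first moments of the gradient vanish, then `F` reproduces itself under
averaging. -/
theorem average_eq_of_trace_gradMoment_eq_zero [CompleteSpace G] {ι : Type*} [Fintype ι]
    {b : ι → E} (hb : ∀ y, ∑ i, B (b i) y • b i = y) (hη : Continuous η)
    (hηs : HasCompactSupport η) (hF : ContDiff ℝ 1 F) (hFs : HasCompactSupport F) (x : E)
    (htr : ∀ δ ∈ Set.Icc (0 : ℝ) 1, ∑ i, gradMoment μ B η F x δ (b i) (b i) = 0) :
    ∫ y, η y • F (x - y) ∂μ = (∫ y, η y ∂μ) • F x := by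
  have hder := hasDerivAt_average μ hη hηs hF hFs x
  have hzero : ∀ δ ∈ Set.Icc (0 : ℝ) 1, ∫ y, η y • fderiv ℝ F (x - δ • y) (-y) ∂μ = 0 := by
    intro δ hδ
    rw [← neg_eq_zero, ← htr δ hδ, ← integral_neg]
    simp only [gradMoment]
    rw [← integral_finsetSum]
    · refine integral_congr_ae (Eventually.of_forall fun y => ?_)
      simp only [map_neg, smul_neg, neg_neg]
      conv_lhs => rw [← hb y]
      rw [map_sum, Finset.smul_sum]
      refine Finset.sum_congr rfl fun i _ => ?_
      rw [map_smul, smul_smul, mul_comm, hb y]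
    · exact fun i _ => integrable_moment_smul μ hη hηs (continuous_fderiv_sub_smul hF x δ _) _
  have hconst := constant_of_derivWithin_zero (a := 0) (b := 1)
    (fun δ _ => (hder δ).differentiableAt.differentiableWithinAt) (fun δ hδ => by
      rw [(hder δ).hasDerivWithinAt.derivWithin
        (uniqueDiffOn_Icc zero_lt_one δ (Set.Ico_subset_Icc_self hδ))]
      exact hzero δ (Set.Ico_subset_Icc_self hδ)) 1 (by simp)
  simpa [integral_smul_const] using hconst

/-- A function that agrees near `x₀` with a multiple of its averages is smooth at `x₀`. -/
theorem contDiffAt_of_average_eq [FiniteDimensional ℝ E] (hη : ContDiff ℝ ∞ η) (hηs : HasCompactSupport η)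
    (hpos : ∫ y, η y ∂μ ≠ 0) (hF : Continuous F) {x₀ : E}
    (h : ∀ᶠ x in 𝓝 x₀, ∫ y, η y • F (x - y) ∂μ = (∫ y, η y ∂μ) • F x) :
    ContDiffAt ℝ ∞ F x₀ := by
  have hsm : ContDiff ℝ ∞ (convolution η F (ContinuousLinearMap.lsmul ℝ ℝ) μ) :=
    hηs.contDiff_convolution_left _ hη hF.locallyIntegrable
  refine (hsm.const_smul (∫ y, η y ∂μ)⁻¹).contDiffAt.congr_of_eventuallyEq ?_
  filter_upwards [h] with x hx
  simp [convolution, hx, smul_smul, inv_mul_cancel₀ hpos]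

end RadialAverages


section CliffordRelations

theorem e_mul_e_add_swap (n : ℕ) (i j : Fin n) :
    e n i * e n j + e n j * e n i = if i = j then -2 else 0 := by
  rw [e, e, CliffordAlgebra.ι_mul_ι_add_swap]
  have h : QuadraticMap.polar (Qe n) (Pi.single i 1) (Pi.single j 1)
      = if i = j then (-2 : ℝ) else 0 := by
    have hpolar : ∀ v w : Fin n → ℝ, QuadraticMap.polar (Qe n) v w = ∑ k, -2 * (v k * w k) := by
      intro v w
      simp only [QuadraticMap.polar, Qe, QuadraticMap.weightedSumSquares_apply,
        ← Finset.sum_sub_distrib]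
      refine Finset.sum_congr rfl fun k _ => ?_
      simp only [Pi.add_apply, smul_eq_mul]
      ring
    simp [hpolar, Pi.single_apply, eq_comm]
  rw [h]
  split_ifs <;> simp [map_ofNat]

theorem finiteDimensional_Cl (n : ℕ) : FiniteDimensional ℝ (Cl n) :=
  have : Invertible (2 : ℝ) := invertibleOfNonzero two_ne_zero
  have := Module.Finite.of_basis (Pi.basisFun ℝ (Fin n)).ExteriorAlgebra
  Module.Finite.equiv (CliffordAlgebra.equivExterior (Qe n)).symm

variable {R : Type*} [Ring R] [Algebra ℝ R] {p : ℕ} {a : Fin p → R}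

theorem sum_anticomm_mul_symm (ha : ∀ i j, a i * a j + a j * a i = if i = j then -2 else 0)
    (T : Fin p → Fin p → R) (hT : ∀ i j, T i j = T j i) :
    ∑ i, ∑ j, a i * (a j * T j i) = -∑ i, T i i := by
  have hswap : ∑ i, ∑ j, a i * (a j * T j i) = ∑ i, ∑ j, a j * (a i * T j i) := by
    rw [Finset.sum_comm]
    exact Finset.sum_congr rfl fun i _ => Finset.sum_congr rfl fun j _ => by rw [hT]
  have hdouble : (2 : ℝ) • ∑ i, ∑ j, a i * (a j * T j i) = (2 : ℝ) • -∑ i, T i i := by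
    rw [two_smul]
    nth_rewrite 2 [hswap]
    simp only [← Finset.sum_add_distrib, ← mul_assoc, ← add_mul, ha, ite_mul, zero_mul]
    simp [two_smul, two_mul, Finset.sum_add_distrib]
  exact smul_right_injective R two_ne_zero hdouble

theorem conj_mul_sum_symm (ha : ∀ i j, a i * a j + a j * a i = if i = j then -2 else 0)
    (T : Fin (p + 1) → Fin (p + 1) → R) (hT : ∀ i j, T i j = T j i) :
    (T 0 0 + ∑ j, a j * T j.succ 0)
        - ∑ i, a i * (T 0 i.succ + ∑ j, a j * T j.succ i.succ) = ∑ i, T i i := by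
  simp only [mul_add, Finset.sum_add_distrib, Finset.mul_sum]
  rw [sum_anticomm_mul_symm ha (fun i j => T i.succ j.succ) fun i j => hT _ _,
    Fin.sum_univ_succ (fun i => T i i)]
  simp only [hT 0]
  abel

theorem mul_conj_sum_symm (ha : ∀ i j, a i * a j + a j * a i = if i = j then -2 else 0)
    (T : Fin (p + 1) → Fin (p + 1) → R) (hT : ∀ i j, T i j = T j i) :
    (T 0 0 - ∑ j, a j * T j.succ 0)
        + ∑ i, a i * (T 0 i.succ - ∑ j, a j * T j.succ i.succ) = ∑ i, T i i := by
  simp only [mul_sub, Finset.sum_sub_distrib, Finset.mul_sum]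
  rw [sum_anticomm_mul_symm ha (fun i j => T i.succ j.succ) fun i j => hT _ _,
    Fin.sum_univ_succ (fun i => T i i)]
  simp only [hT 0]
  abel

end CliffordRelations

section SliceCoordinates

open scoped ContDiff

variable (p : ℕ)

/-- The Euclidean inner product on `ℝ^{p+2}`. -/
def dotSl : Sl p →L[ℝ] Sl p →L[ℝ] ℝ :=
  ∑ i, (((ContinuousLinearMap.proj i : Vp p →L[ℝ] ℝ).comp (.fst ℝ (Vp p) ℝ)).smulRight
      ((ContinuousLinearMap.proj i : Vp p →L[ℝ] ℝ).comp (.fst ℝ (Vp p) ℝ)))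
    + (ContinuousLinearMap.snd ℝ (Vp p) ℝ).smulRight (ContinuousLinearMap.snd ℝ (Vp p) ℝ)

theorem dotSl_apply (v w : Sl p) : dotSl p v w = ∑ i, v.1 i * w.1 i + v.2 * w.2 := by
  simp [dotSl, sum_apply]

theorem dotSl_comm (v w : Sl p) : dotSl p v w = dotSl p w v := by
  simp only [dotSl_apply, mul_comm]

/-- The standard basis of `ℝ^{p+2}`, with `none` labelling the `r`-direction. -/
def stdSl : Option (Fin (p + 1)) → Sl p
  | none => (0, 1)
  | some i => (Pi.single i 1, 0)

theorem sum_dotSl_stdSl (y : Sl p) : ∑ i, dotSl p (stdSl p i) y • stdSl p i = y := by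
  rw [Fintype.sum_option]
  ext j
  · simp [dotSl_apply, stdSl, Prod.fst_sum, Pi.single_apply]
  · simp [dotSl_apply, stdSl, Prod.snd_sum]

theorem norm_sq_le_dotSl (y : Sl p) : ‖y‖ ^ 2 ≤ dotSl p y y := by
  have hsum : ∀ i, y.1 i ^ 2 ≤ ∑ i, y.1 i ^ 2 := fun i =>
    Finset.single_le_sum (fun j _ => sq_nonneg (y.1 j)) (Finset.mem_univ i)
  have h0 : 0 ≤ ∑ i, y.1 i ^ 2 := Finset.sum_nonneg fun j _ => sq_nonneg (y.1 j)
  have hle : ‖y‖ ≤ √(dotSl p y y) := by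
    simp only [dotSl_apply, ← pow_two]
    refine max_le ((pi_norm_le_iff_of_nonneg (Real.sqrt_nonneg _)).2 fun i => ?_) ?_ <;>
      refine Real.le_sqrt_of_sq_le ?_ <;> rw [Real.norm_eq_abs, sq_abs]
    · nlinarith [hsum i, sq_nonneg y.2]
    · linarith
  calc ‖y‖ ^ 2 ≤ √(dotSl p y y) ^ 2 := by gcongr
    _ = dotSl p y y := Real.sq_sqrt (by simp only [dotSl_apply, ← pow_two]; positivity)

/-- A smooth radial weight on `ℝ^{p+2}` supported in the Euclidean ball of radius `ε`. -/
def radialBump (ε : ℝ) (y : Sl p) : ℝ := Real.smoothTransition (ε ^ 2 - dotSl p y y)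

variable {p} {ε : ℝ}

theorem contDiff_radialBump : ContDiff ℝ ∞ (radialBump p ε) := by
  unfold radialBump
  exact Real.smoothTransition.contDiff.comp (by fun_prop)

theorem radialBump_neg (y : Sl p) : radialBump p ε (-y) = radialBump p ε y := by
  simp [radialBump]

theorem norm_lt_of_radialBump_ne_zero (hε : 0 < ε) {y : Sl p} (hy : radialBump p ε y ≠ 0) :
    ‖y‖ < ε := by
  rw [radialBump, Ne, Real.smoothTransition.zero_iff_nonpos] at hy
  nlinarith [norm_sq_le_dotSl p y, norm_nonneg y]

theorem hasCompactSupport_radialBump (hε : 0 < ε) : HasCompactSupport (radialBump p ε) :=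
  HasCompactSupport.intro (isCompact_closedBall 0 ε) fun y hy => by
    by_contra h
    exact hy (by simpa using (norm_lt_of_radialBump_ne_zero hε h).le)

theorem integral_radialBump_pos (hε : 0 < ε) : 0 < ∫ y, radialBump p ε y := by
  refine contDiff_radialBump.continuous.integral_pos_of_hasCompactSupport_nonneg_nonzero
    (hasCompactSupport_radialBump hε) (fun y => Real.smoothTransition.nonneg _) (x := 0) ?_
  simp only [radialBump, map_zero, sub_zero]
  exact (Real.smoothTransition.pos_of_pos (by positivity)).ne'

theorem radialBump_radial (y v w : Sl p) :
    dotSl p w y * fderiv ℝ (radialBump p ε) y v = dotSl p v y * fderiv ℝ (radialBump p ε) y w := by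
  have h2 : HasFDerivAt (fun y => ε ^ 2 - dotSl p y y)
      (-(dotSl p y + (dotSl p).flip y)) y := by
    refine (((dotSl p).hasFDerivAt.clm_apply (hasFDerivAt_id y)).const_sub (ε ^ 2)).congr_fderiv ?_
    ext <;> simp
  have h1 : DifferentiableAt ℝ Real.smoothTransition (ε ^ 2 - dotSl p y y) :=
    (Real.smoothTransition.contDiff (n := 1)).differentiable one_ne_zero _
  have h3 := h1.hasDerivAt.comp_hasFDerivAt y h2
  rw [show radialBump p ε = Real.smoothTransition ∘ fun y => ε ^ 2 - dotSl p y y from rfl, h3.fderiv]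
  simp [dotSl_comm p _ y]
  ring

end SliceCoordinates

section Regularity

open scoped ContDiff

variable {p q : ℕ} {A : Type*} [NormedRing A] [NormedAlgebra ℝ A] (ξ : A ≃ₐ[ℝ] Cl (p + q))

instance : (volume : Measure (Sl p)).IsAddHaarMeasure :=
  inferInstanceAs (((volume : Measure (Vp p)).prod (volume : Measure ℝ)).IsAddHaarMeasure)

theorem eP_mul_eP_add_swap (i j : Fin p) :
    eP p q ξ i * eP p q ξ j + eP p q ξ j * eP p q ξ i = if i = j then -2 else 0 := by
  simp only [eP, gen, ← map_mul, ← map_add, e_mul_e_add_swap, Fin.mk.injEq, Fin.val_inj]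
  split_ifs <;> simp [map_ofNat]

theorem DP_eq (F : Sl p → A) (z : Sl p) :
    DP p q ξ F z = pdSl p 0 F z + ∑ i, eP p q ξ i * pdSl p i.succ F z := by
  simp [DP, Fin.sum_univ_succ, εp, eP]

theorem gradMoment_combination {η : Sl p → ℝ} (hη : Continuous η) (hηs : HasCompactSupport η)
    {F : Sl p → A} (hF : ContDiff ℝ 1 F) (x : Sl p) (δ : ℝ) (w : Sl p) (v : Sl p) {m : ℕ}
    (c : Fin m → A) (u : Fin m → Sl p) :
    gradMoment volume (dotSl p) η F x δ v w + ∑ i, c i * gradMoment volume (dotSl p) η F x δ (u i) w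
      = ∫ y, (dotSl p w y * η y) •
          (fderiv ℝ F (x - δ • y) v + ∑ i, c i * fderiv ℝ F (x - δ • y) (u i)) := by
  have hint : ∀ v, Integrable fun y => (dotSl p w y * η y) • fderiv ℝ F (x - δ • y) v := fun v =>
    integrable_moment_smul volume hη hηs (continuous_fderiv_sub_smul hF x δ v) w
  simp only [gradMoment, ← integral_const_mul_of_integrable (hint _)]
  rw [← integral_finsetSum _ fun i _ => (hint _).const_mul (c i),
    ← integral_add (hint _) (integrable_finsetSum _ fun i _ => (hint _).const_mul (c i))]
  simp only [smul_add, Finset.smul_sum, mul_smul_comm]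

/-- The first moments of the gradients of a solution pair of the generalized Cauchy–Riemann
system are trace free. -/
theorem trace_gradMoment_eq_zero {η : Sl p → ℝ} (hη : ContDiff ℝ 1 η) (hηs : HasCompactSupport η)
    (heven : ∀ y, η (-y) = η y)
    (hrad : ∀ y v w, dotSl p w y * fderiv ℝ η y v = dotSl p v y * fderiv ℝ η y w)
    {F1 F2 : Sl p → A} (hF1 : ContDiff ℝ 1 F1) (hF2 : ContDiff ℝ 1 F2) (x : Sl p) (δ : ℝ)
    (hCR : ∀ y, η y ≠ 0 → DP p q ξ F1 (x - δ • y) - pdr p F2 (x - δ • y) = 0 ∧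
      DPbar p q ξ F2 (x - δ • y) + pdr p F1 (x - δ • y) = 0) :
    ∑ i, gradMoment volume (dotSl p) η F1 x δ (stdSl p i) (stdSl p i) = 0 ∧
      ∑ i, gradMoment volume (dotSl p) η F2 x δ (stdSl p i) (stdSl p i) = 0 := by
  set M : (Sl p → A) → Sl p → Sl p → A := fun F v w => gradMoment volume (dotSl p) η F x δ v w
  have hsymm1 : ∀ v w, M F1 v w = M F1 w v :=
    gradMoment_comm volume (dotSl_comm p) hη hηs heven hrad hF1 x δ
  have hsymm2 : ∀ v w, M F2 v w = M F2 w v :=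
    gradMoment_comm volume (dotSl_comm p) hη hηs heven hrad hF2 x δ
  have hsys1 : ∀ w, M F1 (stdSl p (some 0)) w
      + ∑ i, eP p q ξ i * M F1 (stdSl p (some i.succ)) w = M F2 (stdSl p none) w := by
    intro w
    refine (gradMoment_combination hη.continuous hηs hF1 x δ w (stdSl p (some 0)) (eP p q ξ)
      fun i => stdSl p (some i.succ)).trans (integral_congr_ae (Eventually.of_forall fun y => ?_))
    by_cases hy : η y = 0
    · simp [hy]
    · refine congrArg _ ?_
      exact (DP_eq ξ F1 _).symm.trans (sub_eq_zero.1 (hCR y hy).1)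
  have hsys2 : ∀ w, M F2 (stdSl p (some 0)) w
      - ∑ i, eP p q ξ i * M F2 (stdSl p (some i.succ)) w = -M F1 (stdSl p none) w := by
    intro w
    simp only [sub_eq_add_neg, ← Finset.sum_neg_distrib, ← neg_mul]
    refine (gradMoment_combination hη.continuous hηs hF2 x δ w (stdSl p (some 0))
      (fun i => -eP p q ξ i) fun i => stdSl p (some i.succ)).trans ?_
    simp only [M, gradMoment, ← integral_neg, ← smul_neg]
    refine integral_congr_ae (Eventually.of_forall fun y => ?_)
    by_cases hy : η y = 0
    · simp [hy]
    · simp only [neg_mul, Finset.sum_neg_distrib, ← sub_eq_add_neg]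
      congr 1
      exact eq_neg_of_add_eq_zero_left (hCR y hy).2
  constructor
  · rw [Fintype.sum_option]
    have h := conj_mul_sum_symm (eP_mul_eP_add_swap ξ)
      (fun i j => M F1 (stdSl p (some i)) (stdSl p (some j))) fun i j => hsymm1 _ _
    simp only [hsys1] at h
    simp only [hsymm2 (stdSl p none)] at h
    rw [hsys2] at h
    exact add_eq_zero_iff_eq_neg'.2 h.symm
  · rw [Fintype.sum_option]
    have h := mul_conj_sum_symm (eP_mul_eP_add_swap ξ)
      (fun i j => M F2 (stdSl p (some i)) (stdSl p (some j))) fun i j => hsymm2 _ _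
    simp only [hsys2] at h
    simp only [hsymm1 (stdSl p none), mul_neg, Finset.sum_neg_distrib, ← neg_add] at h
    rw [hsys1] at h
    exact add_eq_zero_iff_eq_neg'.2 h.symm

theorem DP_congr {F H : Sl p → A} {z : Sl p} (h : F =ᶠ[𝓝 z] H) : DP p q ξ F z = DP p q ξ H z := by
  simp only [DP, pdSl, h.fderiv_eq]

theorem DPbar_congr {F H : Sl p → A} {z : Sl p} (h : F =ᶠ[𝓝 z] H) :
    DPbar p q ξ F z = DPbar p q ξ H z := by
  simp only [DPbar, pdSl, h.fderiv_eq]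

theorem pdr_congr {G : Type*} [NormedAddCommGroup G] [NormedSpace ℝ G] {F H : Sl p → G} {z : Sl p}
    (h : F =ᶠ[𝓝 z] H) : pdr p F z = pdr p H z := by
  simp only [pdr, h.fderiv_eq]

theorem contDiff_bump_smul {G : Type*} [NormedAddCommGroup G] [NormedSpace ℝ G] {D : Set (Sl p)}
    (hD : IsOpen D) {z : Sl p} (χ : ContDiffBump z) (hχ : closedBall z χ.rOut ⊆ D) {F : Sl p → G}
    (hF : ContDiffOn ℝ 1 F D) : ContDiff ℝ 1 fun y => χ y • F y := by
  refine contDiff_iff_contDiffAt.2 fun y => ?_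
  by_cases hy : y ∈ tsupport χ
  · exact χ.contDiffAt.smul (hF.contDiffAt (hD.mem_nhds (hχ (χ.tsupport_eq ▸ hy))))
  · refine contDiffAt_const (c := (0 : G)) |>.congr_of_eventuallyEq ?_
    filter_upwards [notMem_tsupport_iff_eventuallyEq.1 hy] with w hw
    simp [hw]

/-- Solutions of class `C¹` of the generalized Cauchy–Riemann system are smooth. -/
theorem CRSystem.contDiffAt {D : Set (Sl p)} (hD : IsOpen D) {F1 F2 : Sl p → A}
    (hF1 : ContDiffOn ℝ 1 F1 D) (hF2 : ContDiffOn ℝ 1 F2 D) (hCR : CRSystem p q ξ D F1 F2)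
    {z : Sl p} (hz : z ∈ D) : ContDiffAt ℝ ∞ F1 z ∧ ContDiffAt ℝ ∞ F2 z := by
  have : FiniteDimensional ℝ A :=
    have := finiteDimensional_Cl (p + q)
    Module.Finite.equiv ξ.symm.toLinearEquiv
  have : CompleteSpace A := FiniteDimensional.complete ℝ A
  obtain ⟨R, hR, hRD⟩ := Metric.nhds_basis_closedBall.mem_iff.1 (hD.mem_nhds hz)
  let χ : ContDiffBump z := ⟨R / 2, R, by positivity, by linarith⟩
  have hcut : ∀ {F : Sl p → A}, ∀ y ∈ ball z (R / 2), (fun y => χ y • F y) =ᶠ[𝓝 y] F := by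
    intro F y hy
    filter_upwards [χ.eventuallyEq_one_of_mem_ball hy] with y hy
    simp [hy]
  have hsub : ball z (R / 2) ⊆ D :=
    ball_subset_closedBall.trans ((closedBall_subset_closedBall (by linarith)).trans hRD)
  have hc1 := contDiff_bump_smul hD χ hRD hF1
  have hc2 := contDiff_bump_smul hD χ hRD hF2
  have hs : ∀ F : Sl p → A, HasCompactSupport fun y => χ y • F y := fun F =>
    χ.hasCompactSupport.smul_right
  have hε : 0 < R / 4 := by positivity
  have htr := fun x hx δ (hδ : δ ∈ Set.Icc (0 : ℝ) 1) =>
    trace_gradMoment_eq_zero ξ (contDiff_radialBump.of_le (by norm_cast))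
      (hasCompactSupport_radialBump hε) radialBump_neg radialBump_radial hc1 hc2 x δ
      fun y hy => by
        have hmem : x - δ • y ∈ ball z (R / 2) := by
          have hy' := norm_lt_of_radialBump_ne_zero hε hy
          have hx' : ‖x - z‖ < R / 4 := by simpa [dist_eq_norm] using hx
          have hδy : ‖δ • y‖ ≤ ‖y‖ := by
            rw [norm_smul, Real.norm_of_nonneg hδ.1]
            exact mul_le_of_le_one_left (norm_nonneg y) hδ.2
          rw [mem_ball, dist_eq_norm, sub_right_comm]
          linarith [norm_sub_le (x - z) (δ • y)]
        rw [DP_congr ξ (hcut _ hmem), DPbar_congr ξ (hcut _ hmem), pdr_congr (hcut _ hmem),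
          pdr_congr (hcut _ hmem)]
        exact hCR _ (hsub hmem)
  have hsmooth : ∀ {F : Sl p → A}, ContDiff ℝ 1 (fun y => χ y • F y) →
      (∀ x ∈ ball z (R / 4), ∀ δ ∈ Set.Icc (0 : ℝ) 1, ∑ i, gradMoment volume (dotSl p)
        (radialBump p (R / 4)) (fun y => χ y • F y) x δ (stdSl p i) (stdSl p i) = 0) →
      ContDiffAt ℝ ∞ F z := by
    intro F hF htr
    refine (contDiffAt_of_average_eq volume contDiff_radialBump (hasCompactSupport_radialBump hε)
      (integral_radialBump_pos hε).ne' hF.continuous ?_).congr_of_eventuallyEq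
      (hcut z (mem_ball_self (by positivity))).symm
    filter_upwards [ball_mem_nhds z hε] with x hx
    exact average_eq_of_trace_gradMoment_eq_zero volume (sum_dotSl_stdSl p)
      contDiff_radialBump.continuous (hasCompactSupport_radialBump hε) hF (hs F) x (htr x hx)
  exact ⟨hsmooth hc1 fun x hx δ hδ => (htr x hx δ hδ).1,
    hsmooth hc2 fun x hx δ hδ => (htr x hx δ hδ).2⟩

end Regularity

section Iterates

open scoped ContDiff

variable {p q : ℕ} {G : Type*} [NormedAddCommGroup G] [NormedSpace ℝ G]
  {A : Type*} [NormedRing A] [NormedAlgebra ℝ A] (ξ : A ≃ₐ[ℝ] Cl (p + q))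

theorem contDiffAt_fderiv_apply {F : Sl p → G} {z : Sl p} (hF : ContDiffAt ℝ ∞ F z) (v : Sl p) :
    ContDiffAt ℝ ∞ (fun w => fderiv ℝ F w v) z :=
  (hF.fderiv_right le_rfl).clm_apply contDiffAt_const

theorem contDiffAt_inv_snd {z : Sl p} (hz : z.2 ≠ 0) :
    ContDiffAt ℝ ∞ (fun w : Sl p => w.2⁻¹) z :=
  contDiffAt_snd.inv hz

theorem contDiffAt_AIter {F : Sl p → A} {z : Sl p} (hz : z.2 ≠ 0) (hF : ContDiffAt ℝ ∞ F z)
    (k : ℕ) : ContDiffAt ℝ ∞ (AIter p F k) z := by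
  induction k with
  | zero => exact hF
  | succ k ih => exact (contDiffAt_inv_snd hz).smul (contDiffAt_fderiv_apply ih _)

theorem contDiffAt_BIter {F : Sl p → A} {z : Sl p} (hz : z.2 ≠ 0) (hF : ContDiffAt ℝ ∞ F z)
    (k : ℕ) : ContDiffAt ℝ ∞ (BIter p F k) z := by
  induction k with
  | zero => exact hF
  | succ k ih => exact contDiffAt_fderiv_apply ((contDiffAt_inv_snd hz).smul ih) _

theorem pdSl_pdr_comm {F : Sl p → G} {z : Sl p} (hF : ContDiffAt ℝ ∞ F z) (i : Fin (p + 1)) :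
    pdSl p i (pdr p F) z = pdr p (pdSl p i F) z := by
  have hd : DifferentiableAt ℝ (fderiv ℝ F) z :=
    (hF.fderiv_right (m := ∞) le_rfl).differentiableAt (by simp)
  have h : ∀ v w, fderiv ℝ (fun y => fderiv ℝ F y v) z w = fderiv ℝ (fderiv ℝ F) z w v := by
    intro v w
    rw [fderiv_clm_apply hd (differentiableAt_const v)]
    simp
  have h2 : minSmoothness ℝ 2 ≤ (∞ : WithTop ℕ∞) := by
    rw [minSmoothness_of_isRCLikeNormedField]
    exact WithTop.coe_le_coe.2 le_top
  exact (h _ _).trans ((hF.isSymmSndFDerivAt h2 _ _).trans (h _ _).symm)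

theorem hasFDerivAt_sum_mul_pdSl {m : ℕ} {F : Sl p → A} {z : Sl p} (hF : ContDiffAt ℝ ∞ F z) (c : Fin m → A)
    (u : Fin m → Fin (p + 1)) :
    HasFDerivAt (fun w => ∑ i, c i * pdSl p (u i) F w)
      (∑ i, c i • fderiv ℝ (pdSl p (u i) F) z) z :=
  HasFDerivAt.fun_sum fun i _ =>
    (((contDiffAt_fderiv_apply hF _).differentiableAt (by simp)).hasFDerivAt.const_mul (c i))

theorem DP_pdr_comm {F : Sl p → A} {z : Sl p} (hF : ContDiffAt ℝ ∞ F z) :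
    DP p q ξ (pdr p F) z = pdr p (DP p q ξ F) z := by
  have h : fderiv ℝ (DP p q ξ F) z = _ :=
    (hasFDerivAt_sum_mul_pdSl hF (εp p q ξ) id).fderiv
  rw [show pdr p (DP p q ξ F) z = fderiv ℝ (DP p q ξ F) z (0, 1) from rfl, h]
  simp [DP, pdSl_pdr_comm hF, pdr, sum_apply]

theorem DPbar_pdr_comm {F : Sl p → A} {z : Sl p} (hF : ContDiffAt ℝ ∞ F z) :
    DPbar p q ξ (pdr p F) z = pdr p (DPbar p q ξ F) z := by
  have h0 : HasFDerivAt (pdSl p 0 F) (fderiv ℝ (pdSl p 0 F) z) z :=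
    ((contDiffAt_fderiv_apply hF _).differentiableAt (by simp)).hasFDerivAt
  have h : fderiv ℝ (DPbar p q ξ F) z = _ :=
    (h0.sub (hasFDerivAt_sum_mul_pdSl hF (eP p q ξ) Fin.succ)).fderiv
  rw [show pdr p (DPbar p q ξ F) z = fderiv ℝ (DPbar p q ξ F) z (0, 1) from rfl, h]
  simp [DPbar, pdSl_pdr_comm hF, pdr, sum_apply]

theorem hasFDerivAt_inv_snd_smul {F : Sl p → G} {z : Sl p} (hz : z.2 ≠ 0)
    (hF : DifferentiableAt ℝ F z) :
    HasFDerivAt (fun w : Sl p => w.2⁻¹ • F w)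
      (z.2⁻¹ • fderiv ℝ F z
        + (-(z.2 ^ 2)⁻¹ • ContinuousLinearMap.snd ℝ (Vp p) ℝ).smulRight (F z)) z :=
  ((hasDerivAt_inv hz).comp_hasFDerivAt z hasFDerivAt_snd).smul hF.hasFDerivAt

theorem pdSl_inv_snd_smul {F : Sl p → G} {z : Sl p} (hz : z.2 ≠ 0) (hF : DifferentiableAt ℝ F z)
    (i : Fin (p + 1)) : pdSl p i (fun w => w.2⁻¹ • F w) z = z.2⁻¹ • pdSl p i F z := by
  simp [pdSl, (hasFDerivAt_inv_snd_smul hz hF).fderiv]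

theorem DP_inv_snd_smul {F : Sl p → A} {z : Sl p} (hz : z.2 ≠ 0) (hF : DifferentiableAt ℝ F z) :
    DP p q ξ (fun w => w.2⁻¹ • F w) z = z.2⁻¹ • DP p q ξ F z := by
  simp [DP, pdSl_inv_snd_smul hz hF, Finset.smul_sum]

theorem DPbar_inv_snd_smul {F : Sl p → A} {z : Sl p} (hz : z.2 ≠ 0) (hF : DifferentiableAt ℝ F z) :
    DPbar p q ξ (fun w => w.2⁻¹ • F w) z = z.2⁻¹ • DPbar p q ξ F z := by
  simp [DPbar, pdSl_inv_snd_smul hz hF, Finset.smul_sum, smul_sub]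

theorem pdr_snd_smul {F : Sl p → G} {z : Sl p} (hF : DifferentiableAt ℝ F z) :
    pdr p (fun w => w.2 • F w) z = F z + z.2 • pdr p F z := by
  have h : HasFDerivAt (fun w : Sl p => w.2 • F w) _ z := hasFDerivAt_snd.smul hF.hasFDerivAt
  simp [pdr, h.fderiv, add_comm]

/-- A solution of the system with parameter `k` is sent by `(F1, F2) ↦ (r⁻¹ ∂_r F1, ∂_r (r⁻¹ F2))` to a
solution of the system with parameter `k + 1`. -/
theorem iterated_CR_step {F1 F2 : Sl p → A} (k : ℕ) {U : Set (Sl p)} (hU : IsOpen U)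
    (hU0 : ∀ z ∈ U, z.2 ≠ 0) (hF1 : ∀ z ∈ U, ContDiffAt ℝ ∞ F1 z)
    (hF2 : ∀ z ∈ U, ContDiffAt ℝ ∞ F2 z)
    (h1 : ∀ z ∈ U, DP p q ξ F1 z - pdr p F2 z = ((2 * (k : ℝ)) / z.2) • F2 z)
    (h2 : ∀ z ∈ U, DPbar p q ξ F2 z + pdr p F1 z = 0) {z : Sl p} (hz : z ∈ U) :
    DP p q ξ (fun w => w.2⁻¹ • pdr p F1 w) z - pdr p (pdr p fun w => w.2⁻¹ • F2 w) z
        = ((2 * ((k + 1 : ℕ) : ℝ)) / z.2) • pdr p (fun w => w.2⁻¹ • F2 w) z ∧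
      DPbar p q ξ (pdr p fun w => w.2⁻¹ • F2 w) z + pdr p (fun w => w.2⁻¹ • pdr p F1 w) z = 0 := by
  have hz0 := hU0 z hz
  have hUz := hU.mem_nhds hz
  have hdiff : ∀ {H : Sl p → A} {w}, ContDiffAt ℝ ∞ H w → DifferentiableAt ℝ H w :=
    fun h => h.differentiableAt (by simp)
  set H : Sl p → A := fun w => w.2⁻¹ • F2 w with hH
  have hHs : ∀ w ∈ U, ContDiffAt ℝ ∞ H w := fun w hw =>
    (contDiffAt_inv_snd (hU0 w hw)).smul (hF2 w hw)
  have hF2H : ∀ w ∈ U, F2 w = w.2 • H w := fun w hw => by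
    simp [hH, smul_smul, mul_inv_cancel₀ (hU0 w hw)]
  have hpdrF2 : ∀ w ∈ U, pdr p F2 w = H w + w.2 • pdr p H w := fun w hw => by
    rw [pdr_congr (eventually_of_mem (hU.mem_nhds hw) hF2H), pdr_snd_smul (hdiff (hHs w hw))]
  have hDPF1 : DP p q ξ F1 =ᶠ[𝓝 z]
      fun w => (2 * (k : ℝ) + 1) • H w + w.2 • pdr p H w := by
    filter_upwards [hUz] with w hw
    rw [eq_add_of_sub_eq (h1 w hw), hpdrF2 w hw, hH]
    module
  have hpdrH : ContDiffAt ℝ ∞ (pdr p H) z := contDiffAt_fderiv_apply (hHs z hz) (0, 1)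
  constructor
  · rw [DP_inv_snd_smul ξ (F := pdr p F1) hz0 (hdiff (contDiffAt_fderiv_apply (hF1 z hz) _)),
      DP_pdr_comm ξ (hF1 z hz), pdr_congr hDPF1]
    have hsum : pdr p (fun w => (2 * (k : ℝ) + 1) • H w + w.2 • pdr p H w) z
        = (2 * (k : ℝ) + 1) • pdr p H z + (pdr p H z + z.2 • pdr p (pdr p H) z) := by
      have hd : HasFDerivAt (fun w : Sl p => (2 * (k : ℝ) + 1) • H w + w.2 • pdr p H w) _ z :=
        ((hdiff (hHs z hz)).hasFDerivAt.const_smul (2 * (k : ℝ) + 1)).add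
          (hasFDerivAt_snd.smul (hdiff hpdrH).hasFDerivAt)
      rw [show pdr p _ z = fderiv ℝ _ z (0, 1) from rfl, hd.fderiv]
      simp [pdr, add_comm]
    rw [hsum]
    match_scalars <;> field_simp <;> ring
  · have hDPbarH : DPbar p q ξ H =ᶠ[𝓝 z] fun w => -(w.2⁻¹ • pdr p F1 w) := by
      filter_upwards [hUz] with w hw
      rw [DPbar_inv_snd_smul ξ (hU0 w hw) (hdiff (hF2 w hw)),
        eq_neg_of_add_eq_zero_left (h2 w hw), smul_neg]
    rw [DPbar_pdr_comm ξ (hHs z hz), pdr_congr hDPbarH]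
    simp [pdr, fderiv_fun_neg]

end Iterates
end GPS

/-- The system (3.7) from the proof of Lemma 3.8.  For
`f = F₁ + ωF₂ ∈ 𝒢𝒮ℛ(Ω_D)`, with `A₀ = F₁`, `B₀ = F₂`,
`A_k = (1/r)∂_r A_{k−1}`, `B_k = ∂_r(B_{k−1}/r)`, one has for all `k ≥ 0`, on
`D ∖ ℝ^{p+1}`: `D_{𝐱_p}A_k − ∂_r B_k = (2k/r) B_k` and `D̄_{𝐱_p}B_k + ∂_r A_k = 0`. -/
theorem iterated_CR_system
    (p q : ℕ) (hq : 1 ≤ q) {A : Type*} [NormedRing A] [NormedAlgebra ℝ A]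
    (ξ : A ≃ₐ[ℝ] Cl (p + q))
    (D : Set (Sl p)) (hD : IsDomain D) (hrefl : ReflInv p D)
    (f : V p q → A) (F1 F2 : Sl p → A)
    (hgsr : GSROnWith p q ξ D f F1 F2) :
    ∀ k : ℕ, ∀ z ∈ D, z.2 ≠ 0 →
      DP p q ξ (AIter p F1 k) z - pdr p (BIter p F2 k) z
          = ((2 * (k : ℝ)) / z.2) • BIter p F2 k z ∧
      DPbar p q ξ (BIter p F2 k) z + pdr p (AIter p F1 k) z = 0 := by
  obtain ⟨-, hF1, hF2, hCR⟩ := hgsr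
  have hopen : IsOpen {z : Sl p | z ∈ D ∧ z.2 ≠ 0} :=
    hD.1.inter (isOpen_ne.preimage continuous_snd)
  have hsmooth := fun z (hz : z ∈ D) => hCR.contDiffAt ξ hD.1 hF1 hF2 hz
  intro k
  induction k with
  | zero =>
    intro z hz _
    simpa [AIter, BIter] using hCR z hz
  | succ k ih =>
    intro z hz hz0
    exact iterated_CR_step ξ k hopen (fun w hw => hw.2)
      (fun w hw => contDiffAt_AIter hw.2 (hsmooth w hw.1).1 k)
      (fun w hw => contDiffAt_BIter hw.2 (hsmooth w hw.1).2 k)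
      (fun w hw => (ih w hw.1 hw.2).1) (fun w hw => (ih w hw.1 hw.2).2) ⟨hz, hz0⟩
end
end
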